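/- arXiv:1011.1186 — 4 statements merged into one kernel-verified Lean document; each statement's English description precedes it below -/
import Mathlib

section
/- Let q, a, b be complex numbers with |q| < 1, and suppose (-a;q)_∞(b;q)_∞ + (a;q)_∞(-b;q)_∞ ≠ 0. Then the continued fraction with partial numerators c₁ = a − b and c_{n+1} = q^{n−1}(a − b·qⁿ)(a·qⁿ − b) for n ≥ 1, and partial denominators bₙ = 1 − q^{2n−1} (that is, (a−b)/(1−q + (a−bq)(aq−b)/(1−q³ + q(a−bq²)(aq²−b)/(1−q⁵ + q²(a−bq³)(aq³−b)/(1−q⁷ + ⋯))))) converges, and its value U satisfies U = ((-a;q)_∞(b;q)_∞ − (a;q)_∞(-b;q)_∞)/((-a;q)_∞(b;q)_∞ + (a;q)_∞(-b;q)_∞). -/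
open Filter

/-- Numerator pairs `(p_{n-1}, p_n)` of the continued fraction
`c 1 / (b 1 + c 2 / (b 2 + ⋯))` (indices start at 1). -/
noncomputable def cfNumC (c b : ℕ → ℂ) : ℕ → ℂ × ℂ
  | 0 => (1, 0)
  | n + 1 => ((cfNumC c b n).2, b (n + 1) * (cfNumC c b n).2 + c (n + 1) * (cfNumC c b n).1)

/-- Denominator pairs `(q_{n-1}, q_n)` of the continued fraction. -/
noncomputable def cfDenC (c b : ℕ → ℂ) : ℕ → ℂ × ℂ
  | 0 => (0, 1)
  | n + 1 => ((cfDenC c b n).2, b (n + 1) * (cfDenC c b n).2 + c (n + 1) * (cfDenC c b n).1)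

/-- The continued fraction with partial numerators `c` and partial denominators `b`
(both indexed from 1) converges to `L`, i.e. its convergents tend to `L`. -/
def CFTendstoC (c b : ℕ → ℂ) (L : ℂ) : Prop :=
  Tendsto (fun n => (cfNumC c b n).2 / (cfDenC c b n).2) atTop (nhds L)

/-- The q-Pochhammer infinite product `(a; q)_∞ = ∏_{n=0}^∞ (1 - a qⁿ)`. -/
noncomputable def qPochC (a q : ℂ) : ℂ := ∏' n : ℕ, (1 - a * q ^ n)



/-- Bound for solutions of a perturbed three-term recurrence. -/
lemma pair_bound (x : ℕ → ℂ × ℂ) (e d : ℕ → ℂ) (C r : ℝ) (hC : 0 ≤ C) (hr0 : 0 ≤ r) (hr : r < 1)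
    (he : ∀ n, ‖e n‖ ≤ C * r ^ n) (hd : ∀ n, ‖d n‖ ≤ C * r ^ n)
    (h0 : ‖x 0‖ ≤ 1)
    (hx : ∀ n, x (n + 1) = ((x n).2, (1 + e n) * (x n).2 + d n * (x n).1)) (n : ℕ) :
    ‖(x (n + 1)).2 - (x n).2‖ ≤ (2 * C * Real.exp (2 * C * (1 - r)⁻¹)) * r ^ n := by
  have key : ∀ n, ‖x n‖ ≤ Real.exp (2 * C * ∑ k ∈ Finset.range n, r ^ k) := by
    intro n
    induction n with
    | zero => simpa using h0
    | succ n ih =>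
      rw [Finset.sum_range_succ, mul_add, Real.exp_add]
      have h1 : ‖(x n).1‖ ≤ ‖x n‖ := norm_fst_le _
      have h2 : ‖(x n).2‖ ≤ ‖x n‖ := norm_snd_le _
      have hrn : 0 ≤ C * r ^ n := by positivity
      have hM := norm_nonneg (x n)
      have hstep : ‖x (n + 1)‖ ≤ ‖x n‖ * (1 + 2 * C * r ^ n) := by
        rw [hx n, Prod.norm_def]
        refine max_le ?_ ?_
        · simp only
          nlinarith
        · simp only
          calc ‖(1 + e n) * (x n).2 + d n * (x n).1‖
              = ‖(x n).2 + e n * (x n).2 + d n * (x n).1‖ := by ring_nf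
            _ ≤ ‖(x n).2‖ + ‖e n‖ * ‖(x n).2‖ + ‖d n‖ * ‖(x n).1‖ := by
              refine (norm_add_le _ _).trans ?_
              rw [norm_mul (d n)]
              gcongr
              refine (norm_add_le _ _).trans ?_
              rw [norm_mul]
            _ ≤ ‖x n‖ + (C * r ^ n) * ‖x n‖ + (C * r ^ n) * ‖x n‖ := by
              gcongr
              · exact he n
              · exact hd n
            _ = _ := by ring
      refine hstep.trans ?_
      have := Real.add_one_le_exp (2 * C * r ^ n)
      gcongr
      linarith
  have hB : ‖x n‖ ≤ Real.exp (2 * C * (1 - r)⁻¹) := by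
    refine (key n).trans ?_
    gcongr
    rw [← tsum_geometric_of_lt_one hr0 hr]
    exact Summable.sum_le_tsum _ (fun i _ => by positivity) (summable_geometric_of_lt_one hr0 hr)
  have h1 : ‖(x n).1‖ ≤ ‖x n‖ := norm_fst_le _
  have h2 : ‖(x n).2‖ ≤ ‖x n‖ := norm_snd_le _
  rw [hx n]
  simp only
  calc ‖(1 + e n) * (x n).2 + d n * (x n).1 - (x n).2‖
      = ‖e n * (x n).2 + d n * (x n).1‖ := by ring_nf
    _ ≤ ‖e n‖ * ‖(x n).2‖ + ‖d n‖ * ‖(x n).1‖ := by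
      refine (norm_add_le _ _).trans ?_
      rw [norm_mul, norm_mul]
    _ ≤ (C * r ^ n) * Real.exp (2 * C * (1 - r)⁻¹) + (C * r ^ n) * Real.exp (2 * C * (1 - r)⁻¹) := by
      gcongr
      · exact he n
      · exact h2.trans hB
      · exact hd n
      · exact h1.trans hB
    _ = _ := by ring

/-- Locally geometrically converging sequences of entire functions have an entire limit. -/
lemma entire_limit (F : ℕ → ℂ → ℂ) (hF : ∀ n, Differentiable ℂ (F n))
    (h : ∀ R : ℝ, ∃ K r : ℝ, 0 ≤ r ∧ r < 1 ∧ ∀ z : ℂ, ‖z‖ < R → ∀ n,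
      ‖F (n + 1) z - F n z‖ ≤ K * r ^ n) :
    ∃ G : ℂ → ℂ, Differentiable ℂ G ∧ ∀ z, Tendsto (fun n => F n z) atTop (nhds (G z)) := by
  refine ⟨fun z => F 0 z + ∑' n, (F (n + 1) z - F n z), ?_, ?_⟩
  · refine (hF 0).add ?_
    intro z
    obtain ⟨K, r, hr0, hr, hb⟩ := h (‖z‖ + 1)
    have := Complex.differentiableOn_tsum_of_summable_norm (U := Metric.ball (0 : ℂ) (‖z‖ + 1))
      (F := fun n z => F (n + 1) z - F n z) (u := fun n => K * r ^ n)
      ((summable_geometric_of_lt_one hr0 hr).mul_left K)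
      (fun i => ((hF (i + 1)).sub (hF i)).differentiableOn) Metric.isOpen_ball
      (fun i w hw => hb w (by simpa using hw) i)
    exact this.differentiableAt (Metric.isOpen_ball.mem_nhds (by simp))
  · intro z
    obtain ⟨K, r, hr0, hr, hb⟩ := h (‖z‖ + 1)
    have hs : Summable fun n => F (n + 1) z - F n z :=
      Summable.of_norm_bounded ((summable_geometric_of_lt_one hr0 hr).mul_left K)
        (fun n => hb z (by linarith) n)
    have := hs.hasSum.tendsto_sum_nat
    simp_rw [Finset.sum_range_sub (fun n => F n z)] at this
    have h2 := this.const_add (F 0 z)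
    simpa using h2

lemma summable_qpow (a q : ℂ) (hq : ‖q‖ < 1) : Summable fun n : ℕ => ‖-(a * q ^ n)‖ := by
  simp only [norm_neg, norm_mul, norm_pow]
  exact (summable_geometric_of_lt_one (norm_nonneg _) hq).mul_left _

lemma qPoch_tendsto (a q : ℂ) (hq : ‖q‖ < 1) :
    Tendsto (fun N => ∏ n ∈ Finset.range N, (1 - a * q ^ n)) atTop (nhds (qPochC a q)) := by
  have := (multipliable_one_add_of_summable (summable_qpow a q hq)).tendsto_prod_tprod_nat
  simpa [qPochC, sub_eq_add_neg] using this

lemma qPoch_ne_zero (a q : ℂ) (hq : ‖q‖ < 1) (h : ∀ n : ℕ, 1 - a * q ^ n ≠ 0) :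
    qPochC a q ≠ 0 := by
  have := tprod_one_add_ne_zero_of_summable (f := fun n : ℕ => -(a * q ^ n))
    (fun i => by simpa [sub_eq_add_neg] using h i) (summable_qpow a q hq)
  simpa [qPochC, sub_eq_add_neg] using this

lemma qPoch_differentiable (a q : ℂ) (hq : ‖q‖ < 1) :
    Differentiable ℂ (fun z => qPochC (a * z) q) := by
  obtain ⟨G, hG, hGt⟩ := entire_limit
    (fun N z => ∏ n ∈ Finset.range N, (1 - (a * z) * q ^ n)) (by intro n; fun_prop) (by
      intro R
      refine ⟨2 * (‖a‖ * |R|) * Real.exp (2 * (‖a‖ * |R|) * (1 - ‖q‖)⁻¹), ‖q‖, norm_nonneg _, hq, ?_⟩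
      intro z hz n
      have := pair_bound (fun N => (if N = 0 then 0 else
          ∏ n ∈ Finset.range (N - 1), (1 - (a * z) * q ^ n),
          ∏ n ∈ Finset.range N, (1 - (a * z) * q ^ n))) (fun n => - (a * z) * q ^ n) (fun _ => 0)
        (‖a‖ * |R|) ‖q‖ (by positivity) (norm_nonneg _) hq (by
          intro n
          rw [norm_mul, norm_neg, norm_mul, norm_pow]
          gcongr
          exact hz.le.trans (le_abs_self R)) (by intro n; simp; positivity) (by simp)
          (by
            intro n
            simp [Finset.prod_range_succ]
            ring) n
      simpa using this)
  have : (fun z => qPochC (a * z) q) = G := by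
    funext z
    exact tendsto_nhds_unique (qPoch_tendsto (a * z) q hq) (hGt z)
  rw [this]; exact hG

/-- Partial numerators. -/
noncomputable def cC (q a b : ℂ) : ℕ → ℂ := fun n => if n = 1 then a - b
        else q ^ (n - 2) * (a - b * q ^ (n - 1)) * (a * q ^ (n - 1) - b)

/-- Partial denominators. -/
noncomputable def bC (q : ℂ) : ℕ → ℂ := fun n => 1 - q ^ (2 * n - 1)

lemma cC_one (q a b : ℂ) : cC q a b 1 = a - b := by simp [cC]

lemma cC_add_two (q a b : ℂ) (n : ℕ) :
    cC q a b (n + 2) = q ^ n * (a - b * q ^ (n + 1)) * (a * q ^ (n + 1) - b) := by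
  simp [cC]

lemma bC_succ (q : ℂ) (n : ℕ) : bC q (n + 1) = 1 - q ^ (2 * n + 1) := by
  simp only [bC]; congr 2

lemma cC_bound (q a b : ℂ) (S : ℝ) (hS : ‖a‖ + ‖b‖ ≤ S) (hq : ‖q‖ < 1) (n : ℕ) :
    ‖cC q a b (n + 1)‖ ≤ (2 * S ^ 2 + S + 1) * (max ‖q‖ (1 / 2)) ^ n := by
  have hab := add_nonneg (norm_nonneg a) (norm_nonneg b)
  have hS0 : 0 ≤ S := hab.trans hS
  rcases n with _ | n
  · rw [cC_one]
    have := norm_sub_le a b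
    simp
    nlinarith
  · rw [cC_add_two, norm_mul, norm_mul, norm_pow]
    have hqn : ‖q ^ (n + 1)‖ ≤ 1 := by
      rw [norm_pow]; exact pow_le_one₀ (norm_nonneg _) hq.le
    have h1 : ‖a - b * q ^ (n + 1)‖ ≤ S := by
      refine (norm_sub_le _ _).trans ?_
      rw [norm_mul]
      nlinarith [norm_nonneg b]
    have h2 : ‖a * q ^ (n + 1) - b‖ ≤ S := by
      refine (norm_sub_le _ _).trans ?_
      rw [norm_mul]
      nlinarith [norm_nonneg a]
    set r := max ‖q‖ (1 / 2) with hr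
    have hr2 : 1 / 2 ≤ r := le_max_right _ _
    have hqr : ‖q‖ ≤ r := le_max_left _ _
    have hr0 : 0 ≤ r := by linarith
    calc ‖q‖ ^ n * ‖a - b * q ^ (n + 1)‖ * ‖a * q ^ (n + 1) - b‖ ≤ r ^ n * S * S := by gcongr
      _ = S ^ 2 * r ^ n := by ring
      _ ≤ (2 * S ^ 2 + S + 1) * r * r ^ n := by
        gcongr
        nlinarith [sq_nonneg S]
      _ = _ := by ring

lemma bC_bound (q : ℂ) (S : ℝ) (hS : 0 ≤ S) (hq : ‖q‖ < 1) (n : ℕ) :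
    ‖bC q (n + 1) - 1‖ ≤ (2 * S ^ 2 + S + 1) * (max ‖q‖ (1 / 2)) ^ n := by
  rw [bC_succ]
  simp only [sub_sub_cancel_left, norm_neg, norm_pow]
  set r := max ‖q‖ (1 / 2) with hr
  have hqr : ‖q‖ ≤ r := le_max_left _ _
  have hr0 : 0 ≤ r := (norm_nonneg _).trans hqr
  calc ‖q‖ ^ (2 * n + 1) ≤ ‖q‖ ^ n := pow_le_pow_of_le_one (norm_nonneg _) hq.le (by omega)
    _ ≤ r ^ n := by gcongr
    _ = 1 * r ^ n := by ring
    _ ≤ _ := by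
      gcongr
      nlinarith [sq_nonneg S]

lemma cC_diff (q a b : ℂ) (n : ℕ) : Differentiable ℂ (fun z => cC q (a * z) (b * z) (n + 1)) := by
  rcases n with _ | n
  · simp only [zero_add, cC_one]; fun_prop
  · simp only [cC_add_two]; fun_prop

lemma scaled_bound (a b z : ℂ) (R : ℝ) (hz : ‖z‖ < R) :
    ‖a * z‖ + ‖b * z‖ ≤ (‖a‖ + ‖b‖) * |R| := by
  rw [norm_mul, norm_mul, ← add_mul]
  gcongr
  exact hz.le.trans (le_abs_self R)

lemma cf_entire (q a b : ℂ) (hq : ‖q‖ < 1) (x : ℂ → ℕ → ℂ × ℂ) (u : ℂ × ℂ)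
    (h0 : ∀ z, x z 0 = u) (hu : ‖u‖ ≤ 1)
    (hx : ∀ z n, x z (n + 1) = ((x z n).2,
      bC q (n + 1) * (x z n).2 + cC q (a * z) (b * z) (n + 1) * (x z n).1)) :
    ∃ G : ℂ → ℂ, Differentiable ℂ G ∧ ∀ z, Tendsto (fun n => (x z n).2) atTop (nhds (G z)) := by
  refine entire_limit (fun n z => (x z n).2) ?_ ?_
  · have : ∀ n, Differentiable ℂ (fun z => (x z n).1) ∧ Differentiable ℂ (fun z => (x z n).2) := by
      intro n
      induction n with
      | zero => simp [h0]
      | succ n ih =>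
        obtain ⟨i1, i2⟩ := ih
        have := cC_diff q a b n
        simp only [hx]
        exact ⟨i2, by fun_prop⟩
    exact fun n => (this n).2
  · intro R
    set S := (‖a‖ + ‖b‖) * |R| with hS
    have hS0 : 0 ≤ S := by positivity
    refine ⟨_, max ‖q‖ (1 / 2), by positivity, max_lt hq (by norm_num), fun z hz n =>
      pair_bound (x z) (fun n => bC q (n + 1) - 1) (fun n => cC q (a * z) (b * z) (n + 1))
        (2 * S ^ 2 + S + 1) (max ‖q‖ (1 / 2)) (by positivity) (by positivity)
        (max_lt hq (by norm_num)) (bC_bound q S hS0 hq)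
        (cC_bound q _ _ S (scaled_bound a b z R hz) hq) (by rw [h0]; exact hu) ?_ n⟩
    intro n
    rw [hx]; simp

lemma one_sub_pow_norm (q : ℂ) (hq : ‖q‖ < 1) (m : ℕ) : 1 - ‖q‖ ≤ ‖1 - q ^ (m + 1)‖ := by
  have h1 : ‖q ^ (m + 1)‖ ≤ ‖q‖ := by
    rw [norm_pow]; exact pow_le_of_le_one (norm_nonneg _) hq.le (by omega)
  have := norm_sub_norm_le (1 : ℂ) (q ^ (m + 1))
  rw [norm_one] at this
  linarith

lemma one_sub_pow_ne (q : ℂ) (hq : ‖q‖ < 1) (m : ℕ) : 1 - q ^ (m + 1) ≠ 0 := by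
  rw [← norm_pos_iff]
  exact lt_of_lt_of_le (by linarith) (one_sub_pow_norm q hq m)

lemma factor_bound (q a b : ℂ) (hq : ‖q‖ < 1) (hs : ‖a‖ + ‖b‖ ≤ (1 - ‖q‖) / 2) (j m : ℕ) :
    ‖(a - b * q ^ j) / (1 - q ^ (m + 1))‖ ≤ 1 / 2 := by
  have h0 := one_sub_pow_norm q hq m
  rw [norm_div, div_le_iff₀ (by linarith)]
  have hqn : ‖q ^ j‖ ≤ 1 := by
    rw [norm_pow]; exact pow_le_one₀ (norm_nonneg _) hq.le
  have h1 : ‖a - b * q ^ j‖ ≤ ‖a‖ + ‖b‖ := by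
    refine (norm_sub_le _ _).trans ?_
    rw [norm_mul]
    nlinarith [norm_nonneg b]
  linarith

lemma prod_half_bound (g : ℕ → ℂ) (hg : ∀ j, ‖g j‖ ≤ 1 / 2) (k : ℕ) :
    ‖∏ j ∈ Finset.range k, g j‖ ≤ (1 / 2 : ℝ) ^ k := by
  rw [norm_prod]
  calc ∏ j ∈ Finset.range k, ‖g j‖ ≤ ∏ j ∈ Finset.range k, (1 / 2 : ℝ) :=
        Finset.prod_le_prod (fun _ _ => norm_nonneg _) (fun j _ => hg j)
    _ = _ := by simp

/-- Terms of the q-binomial series. -/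
noncomputable def tq (q a b : ℂ) (k : ℕ) : ℂ :=
  ∏ j ∈ Finset.range k, ((a - b * q ^ j) / (1 - q ^ (j + 1)))

lemma tq_bound (q a b : ℂ) (hq : ‖q‖ < 1) (hs : ‖a‖ + ‖b‖ ≤ (1 - ‖q‖) / 2) (k : ℕ) :
    ‖tq q a b k‖ ≤ (1 / 2 : ℝ) ^ k :=
  prod_half_bound _ (fun j => factor_bound q a b hq hs j j) k

lemma tq_summable (q a b : ℂ) (hq : ‖q‖ < 1) (hs : ‖a‖ + ‖b‖ ≤ (1 - ‖q‖) / 2) :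
    Summable (tq q a b) :=
  Summable.of_norm_bounded (summable_geometric_of_lt_one (by norm_num) (by norm_num))
    (tq_bound q a b hq hs)

lemma tq_summable_pow (q a b w : ℂ) (hq : ‖q‖ < 1) (hs : ‖a‖ + ‖b‖ ≤ (1 - ‖q‖) / 2)
    (hw : ‖w‖ ≤ 1) : Summable (fun k => tq q a b k * w ^ k) := by
  refine Summable.of_norm_bounded (summable_geometric_of_lt_one (r := 1 / 2)
    (by norm_num) (by norm_num)) (fun k => ?_)
  rw [norm_mul, norm_pow]
  have := tq_bound q a b hq hs k
  have h2 : ‖w‖ ^ k ≤ 1 := pow_le_one₀ (norm_nonneg _) hw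
  nlinarith [norm_nonneg (tq q a b k)]

lemma tq_step (q a b w : ℂ) (hq : ‖q‖ < 1) (hs : ‖a‖ + ‖b‖ ≤ (1 - ‖q‖) / 2) (hw : ‖w‖ ≤ 1) :
    (1 - a * w) * ∑' k, tq q a b k * w ^ k = (1 - b * w) * ∑' k, tq q a b k * (q * w) ^ k := by
  have hqw : ‖q * w‖ ≤ 1 := by
    rw [norm_mul]; exact mul_le_one₀ hq.le (norm_nonneg _) hw
  have s1 := tq_summable_pow q a b w hq hs hw
  have s2 := tq_summable_pow q a b (q * w) hq hs hqw
  have e1 : ∑' k, tq q a b k * w ^ k - ∑' k, tq q a b k * (q * w) ^ k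
      = ∑' k, (a * w * (tq q a b k * w ^ k) - b * w * (tq q a b k * (q * w) ^ k)) := by
    rw [← s1.tsum_sub s2, (s1.sub s2).tsum_eq_zero_add]
    simp only [pow_zero, sub_self, zero_add]
    refine tsum_congr fun k => ?_
    have := one_sub_pow_ne q hq k
    have h : tq q a b (k + 1) * (1 - q ^ (k + 1)) = tq q a b k * (a - b * q ^ k) := by
      unfold tq
      rw [Finset.prod_range_succ]
      field_simp
    calc _ = tq q a b (k + 1) * (1 - q ^ (k + 1)) * w ^ (k + 1) := by ring
      _ = _ := by rw [h]; ring
  rw [(s1.mul_left (a * w)).tsum_sub (s2.mul_left (b * w)), tsum_mul_left, tsum_mul_left] at e1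
  linear_combination e1

/-- The q-binomial theorem, for small parameters. -/
lemma qbinom (q a b : ℂ) (hq : ‖q‖ < 1) (hs : ‖a‖ + ‖b‖ ≤ (1 - ‖q‖) / 2) :
    qPochC a q * ∑' k, tq q a b k = qPochC b q := by
  have hN : ∀ N, (∏ n ∈ Finset.range N, (1 - a * q ^ n)) * ∑' k, tq q a b k =
      (∏ n ∈ Finset.range N, (1 - b * q ^ n)) * ∑' k, tq q a b k * (q ^ N) ^ k := by
    intro N
    induction N with
    | zero => simp
    | succ N ih =>
      have hw : ‖q ^ N‖ ≤ 1 := by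
        rw [norm_pow]; exact pow_le_one₀ (norm_nonneg _) hq.le
      have := tq_step q a b (q ^ N) hq hs hw
      rw [Finset.prod_range_succ, Finset.prod_range_succ, mul_right_comm, ih, pow_succ' q N]
      linear_combination (∏ n ∈ Finset.range N, (1 - b * q ^ n)) * this
  have hlim : Tendsto (fun N : ℕ => ∑' k, tq q a b k * (q ^ N) ^ k) atTop
      (nhds (∑' k, if k = 0 then (1 : ℂ) else 0)) := by
    refine tendsto_tsum_of_dominated_convergence (bound := fun k => (1 / 2 : ℝ) ^ k)
      (summable_geometric_of_lt_one (by norm_num) (by norm_num)) ?_ ?_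
    · intro k
      rcases k with _ | k
      · simp [tq]
      · have h1 : Tendsto (fun N : ℕ => q ^ N) atTop (nhds 0) :=
          tendsto_pow_atTop_nhds_zero_of_norm_lt_one hq
        have := (h1.pow (k + 1)).const_mul (tq q a b (k + 1))
        simpa using this
    · refine Eventually.of_forall fun N k => ?_
      rw [norm_mul, norm_pow, norm_pow]
      have := tq_bound q a b hq hs k
      have h2 : (‖q‖ ^ N) ^ k ≤ 1 := pow_le_one₀ (by positivity) (pow_le_one₀ (norm_nonneg _) hq.le)
      nlinarith [norm_nonneg (tq q a b k)]
  rw [tsum_ite_eq] at hlim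
  have l1 := (qPoch_tendsto a q hq).mul_const (∑' k, tq q a b k)
  have l2 := (qPoch_tendsto b q hq).mul hlim
  simp_rw [hN] at l1
  simpa using tendsto_nhds_unique l1 l2

/-- Terms of the contiguous family of basic hypergeometric series. -/
noncomputable def uq (q a b : ℂ) (n k : ℕ) : ℂ :=
  ∏ j ∈ Finset.range k, ((a - b * q ^ (n + 2 * j)) / (1 - q ^ (2 * n + 2 * j + 1)) *
    ((a - b * q ^ (n + 2 * j + 1)) / (1 - q ^ (2 * j + 1 + 1))))

lemma uq_bound (q a b : ℂ) (hq : ‖q‖ < 1) (hs : ‖a‖ + ‖b‖ ≤ (1 - ‖q‖) / 2) (n k : ℕ) :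
    ‖uq q a b n k‖ ≤ (1 / 2 : ℝ) ^ k := by
  refine prod_half_bound _ (fun j => ?_) k
  rw [norm_mul]
  have h1 := factor_bound q a b hq hs (n + 2 * j) (2 * n + 2 * j)
  have h2 := factor_bound q a b hq hs (n + 2 * j + 1) (2 * j + 1)
  nlinarith [norm_nonneg ((a - b * q ^ (n + 2 * j)) / (1 - q ^ (2 * n + 2 * j + 1))),
    norm_nonneg ((a - b * q ^ (n + 2 * j + 1)) / (1 - q ^ (2 * j + 1 + 1)))]

lemma uq_summable (q a b : ℂ) (hq : ‖q‖ < 1) (hs : ‖a‖ + ‖b‖ ≤ (1 - ‖q‖) / 2) (n : ℕ) :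
    Summable (uq q a b n) :=
  Summable.of_norm_bounded (summable_geometric_of_lt_one (by norm_num) (by norm_num))
    (uq_bound q a b hq hs n)

lemma uq_shift_two (q a b : ℂ) (hq : ‖q‖ < 1) (n k : ℕ) :
    uq q a b n (k + 1) * ((1 - q ^ (2 * n + 1)) * (1 - q ^ (2 * n + 3)) * (1 - q ^ (2 * k + 2))) =
      uq q a b (n + 2) k * ((a - b * q ^ n) * (a - b * q ^ (n + 1)) *
        (1 - q ^ (2 * n + 2 * k + 3))) := by
  induction k with
  | zero =>
    have h1 := one_sub_pow_ne q hq (2 * n)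
    have h2 := one_sub_pow_ne q hq 1
    simp [uq]
    norm_num at h2
    field_simp
  | succ k ih =>
    have h1 := one_sub_pow_ne q hq (2 * n + 2 * k + 2)
    have h2 := one_sub_pow_ne q hq (2 * n + 2 * k + 4)
    have h3 := one_sub_pow_ne q hq (2 * k + 1)
    have h4 := one_sub_pow_ne q hq (2 * k + 3)
    have e1 : uq q a b n (k + 1 + 1) = uq q a b n (k + 1) *
        ((a - b * q ^ (n + 2 * k + 2)) * (a - b * q ^ (n + 2 * k + 3)) /
          ((1 - q ^ (2 * n + 2 * k + 2 + 1)) * (1 - q ^ (2 * k + 3 + 1)))) := by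
      rw [uq, Finset.prod_range_succ, ← uq, div_mul_div_comm]
      ring_nf
    have e2 : uq q a b (n + 2) (k + 1) = uq q a b (n + 2) k *
        ((a - b * q ^ (n + 2 * k + 2)) * (a - b * q ^ (n + 2 * k + 3)) /
          ((1 - q ^ (2 * n + 2 * k + 4 + 1)) * (1 - q ^ (2 * k + 1 + 1)))) := by
      rw [uq, Finset.prod_range_succ, ← uq, div_mul_div_comm]
      ring_nf
    rw [e1, e2]
    have e3 : 2 * (k + 1) + 2 = 2 * k + 3 + 1 := by ring
    have e4 : 2 * n + 2 * (k + 1) + 3 = 2 * n + 2 * k + 4 + 1 := by ring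
    rw [e3, e4]
    have e5 : 2 * n + 2 * k + 3 = 2 * n + 2 * k + 2 + 1 := by ring
    have e6 : 2 * k + 2 = 2 * k + 1 + 1 := by ring
    rw [e5, e6] at ih
    generalize q ^ (2 * n + 2 * k + 2 + 1) = A at *
    generalize q ^ (2 * n + 2 * k + 4 + 1) = B at *
    generalize q ^ (2 * k + 1 + 1) = C at *
    generalize q ^ (2 * k + 3 + 1) = D at *
    field_simp
    linear_combination (a - b * q ^ (n + 2 * k + 2)) * (a - b * q ^ (n + 2 * k + 3)) * ih

lemma uq_shift_one (q a b : ℂ) (hq : ‖q‖ < 1) (n k : ℕ) :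
    uq q a b (n + 1) (k + 1) * ((1 - q ^ (2 * n + 3)) * (1 - q ^ (2 * k + 2))) =
      uq q a b (n + 2) k * ((a - b * q ^ (n + 1)) * (a - b * q ^ (n + 2 * k + 2))) := by
  induction k with
  | zero =>
    have h1 := one_sub_pow_ne q hq (2 * n + 2)
    have h2 := one_sub_pow_ne q hq 1
    simp [uq]
    norm_num at h2
    have e : 2 * (n + 1) + 1 = 2 * n + 2 + 1 := by ring
    rw [e]
    field_simp
  | succ k ih =>
    have h1 := one_sub_pow_ne q hq (2 * n + 2 * k + 4)
    have h3 := one_sub_pow_ne q hq (2 * k + 1)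
    have h4 := one_sub_pow_ne q hq (2 * k + 3)
    have e1 : uq q a b (n + 1) (k + 1 + 1) = uq q a b (n + 1) (k + 1) *
        ((a - b * q ^ (n + 2 * k + 3)) * (a - b * q ^ (n + 2 * k + 4)) /
          ((1 - q ^ (2 * n + 2 * k + 4 + 1)) * (1 - q ^ (2 * k + 3 + 1)))) := by
      rw [uq, Finset.prod_range_succ, ← uq, div_mul_div_comm]
      ring_nf
    have e2 : uq q a b (n + 2) (k + 1) = uq q a b (n + 2) k *
        ((a - b * q ^ (n + 2 * k + 2)) * (a - b * q ^ (n + 2 * k + 3)) /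
          ((1 - q ^ (2 * n + 2 * k + 4 + 1)) * (1 - q ^ (2 * k + 1 + 1)))) := by
      rw [uq, Finset.prod_range_succ, ← uq, div_mul_div_comm]
      ring_nf
    rw [e1, e2]
    have e3 : 2 * (k + 1) + 2 = 2 * k + 3 + 1 := by ring
    have e4 : n + 2 * (k + 1) + 2 = n + 2 * k + 4 := by ring
    rw [e3, e4]
    have e6 : 2 * k + 2 = 2 * k + 1 + 1 := by ring
    have e7 : n + 2 * k + 2 = n + 2 * k + 1 + 1 := by ring
    rw [e6] at ih
    generalize q ^ (2 * n + 2 * k + 4 + 1) = B at *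
    generalize q ^ (2 * k + 1 + 1) = C at *
    generalize q ^ (2 * k + 3 + 1) = D at *
    field_simp
    linear_combination (a - b * q ^ (n + 2 * k + 4)) * (a - b * q ^ (n + 2 * k + 3)) * ih

/-- The contiguous family. -/
noncomputable def phiq (q a b : ℂ) (n : ℕ) : ℂ := ∑' k, uq q a b n k

lemma phiq_rec (q a b : ℂ) (hq : ‖q‖ < 1) (hs : ‖a‖ + ‖b‖ ≤ (1 - ‖q‖) / 2) (n : ℕ) :
    phiq q a b n = phiq q a b (n + 1) + cC q a b (n + 2) /
      ((1 - q ^ (2 * n + 1)) * (1 - q ^ (2 * n + 3))) * phiq q a b (n + 2) := by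
  have s0 := uq_summable q a b hq hs n
  have s1 := uq_summable q a b hq hs (n + 1)
  unfold phiq
  rw [← sub_eq_iff_eq_add', ← s0.tsum_sub s1, (s0.sub s1).tsum_eq_zero_add, ← tsum_mul_left]
  have : uq q a b n 0 - uq q a b (n + 1) 0 = 0 := by simp [uq]
  rw [this, zero_add]
  refine tsum_congr fun k => ?_
  have h1 := one_sub_pow_ne q hq (2 * n)
  have h2 := one_sub_pow_ne q hq (2 * n + 2)
  have h3 := one_sub_pow_ne q hq (2 * k + 1)
  have e1 := uq_shift_two q a b hq n k
  have e2 := uq_shift_one q a b hq n k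
  rw [cC_add_two, div_mul_eq_mul_div, eq_div_iff (mul_ne_zero h1 h2)]
  refine mul_right_cancel₀ h3 ?_
  linear_combination e1 - (1 - q ^ (2 * n + 1)) * e2

lemma uq_zero (q a b : ℂ) (k : ℕ) : uq q a b 0 k = tq q a b (2 * k) := by
  induction k with
  | zero => simp [uq, tq]
  | succ k ih =>
    rw [uq, Finset.prod_range_succ, ← uq, ih, show 2 * (k + 1) = 2 * k + 1 + 1 by ring]
    unfold tq
    rw [Finset.prod_range_succ, Finset.prod_range_succ]
    simp only [zero_add, mul_zero]
    ring

lemma uq_one (q a b : ℂ) (k : ℕ) :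
    (a - b) / (1 - q) * uq q a b 1 k = tq q a b (2 * k + 1) := by
  induction k with
  | zero => simp [uq, tq]
  | succ k ih =>
    rw [uq, Finset.prod_range_succ, ← uq, ← mul_assoc, ih,
      show 2 * (k + 1) + 1 = 2 * k + 1 + 1 + 1 by ring]
    unfold tq
    rw [Finset.prod_range_succ _ (2 * k + 1 + 1), Finset.prod_range_succ _ (2 * k + 1)]
    have e1 : 2 * 1 + 2 * k + 1 = 2 * k + 1 + 1 + 1 := by ring
    have e2 : 1 + 2 * k + 1 = 2 * k + 1 + 1 := by ring
    have e3 : 1 + 2 * k = 2 * k + 1 := by ring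
    rw [e1, e2, e3]
    simp only [div_eq_mul_inv]
    ring

lemma tq_neg (q a b : ℂ) (k : ℕ) : tq q (-a) (-b) k = (-1) ^ k * tq q a b k := by
  induction k with
  | zero => simp [tq]
  | succ k ih =>
    rw [tq, Finset.prod_range_succ, ← tq, ih, tq, tq, Finset.prod_range_succ]
    ring

lemma phi_sum (q a b : ℂ) (hq : ‖q‖ < 1) (hs : ‖a‖ + ‖b‖ ≤ (1 - ‖q‖) / 2) :
    phiq q a b 0 + (a - b) / (1 - q) * phiq q a b 1 = ∑' k, tq q a b k := by
  have s := tq_summable q a b hq hs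
  rw [← tsum_even_add_odd (f := tq q a b)
    (s.comp_injective (i := fun k => 2 * k) (fun x y h => by simpa using h))
    (s.comp_injective (i := fun k => 2 * k + 1) (fun x y h => by simpa using h))]
  unfold phiq
  rw [← tsum_mul_left]
  simp_rw [uq_zero, uq_one q a b]

lemma phi_diff (q a b : ℂ) (hq : ‖q‖ < 1) (hs : ‖a‖ + ‖b‖ ≤ (1 - ‖q‖) / 2) :
    phiq q a b 0 - (a - b) / (1 - q) * phiq q a b 1 = ∑' k, tq q (-a) (-b) k := by
  have s := tq_summable q (-a) (-b) hq (by simpa using hs)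
  rw [← tsum_even_add_odd (f := tq q (-a) (-b))
    (s.comp_injective (i := fun k => 2 * k) (fun x y h => by simpa using h))
    (s.comp_injective (i := fun k => 2 * k + 1) (fun x y h => by simpa using h))]
  unfold phiq
  rw [← tsum_mul_left]
  simp_rw [uq_zero, uq_one q a b, tq_neg]
  simp [pow_succ, pow_mul, tsum_neg, sub_eq_add_neg]

lemma phi_lim (q a b : ℂ) (hq : ‖q‖ < 1) (hs : ‖a‖ + ‖b‖ ≤ (1 - ‖q‖) / 2) :
    Tendsto (phiq q a b) atTop (nhds (∑' k, tq (q ^ 2) (a ^ 2) 0 k)) := by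
  unfold phiq
  refine tendsto_tsum_of_dominated_convergence (bound := fun k => (1 / 2 : ℝ) ^ k)
      (summable_geometric_of_lt_one (by norm_num) (by norm_num)) ?_
      (Eventually.of_forall fun n k => uq_bound q a b hq hs n k)
  intro k
  unfold uq tq
  refine tendsto_finsetProd _ fun j _ => ?_
  have h1 : ∀ m : ℕ → ℕ, (∀ n, n ≤ m n) → Tendsto (fun N : ℕ => q ^ (m N)) atTop (nhds 0) :=
    fun m hm => (tendsto_pow_atTop_nhds_zero_of_norm_lt_one hq).comp
      (tendsto_atTop_mono hm tendsto_id)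
  have t1 := h1 (fun n => n + 2 * j) (fun n => by omega)
  have t2 := h1 (fun n => 2 * n + 2 * j + 1) (fun n => by omega)
  have t3 := h1 (fun n => n + 2 * j + 1) (fun n => by omega)
  have := (((t1.const_mul b).const_sub a).div (t2.const_sub 1) (by simp)).mul
    (((t3.const_mul b).const_sub a).div_const (1 - q ^ (2 * j + 1 + 1)))
  have e : (a ^ 2 - 0 * (q ^ 2) ^ j) / (1 - (q ^ 2) ^ (j + 1)) =
      (a - b * 0) / (1 - 0) * ((a - b * 0) / (1 - q ^ (2 * j + 1 + 1))) := by
    simp only [mul_zero, sub_zero, zero_mul, div_one, ← pow_mul]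
    rw [show 2 * (j + 1) = 2 * j + 1 + 1 by ring]
    ring
  rw [e]
  exact this

lemma poch_sq (q a : ℂ) (hq : ‖q‖ < 1) :
    qPochC a q * qPochC (-a) q = qPochC (a ^ 2) (q ^ 2) := by
  have hq2 : ‖q ^ 2‖ < 1 := by
    rw [norm_pow]; exact pow_lt_one₀ (norm_nonneg _) hq (by norm_num)
  refine tendsto_nhds_unique ((qPoch_tendsto a q hq).mul (qPoch_tendsto (-a) q hq)) ?_
  convert qPoch_tendsto (a ^ 2) (q ^ 2) hq2 using 2 with N
  rw [← Finset.prod_mul_distrib]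
  refine Finset.prod_congr rfl fun n _ => ?_
  rw [← pow_mul, mul_comm 2 n, pow_mul]
  ring

lemma phi_lim_eq (q a b : ℂ) (hq : ‖q‖ < 1) (hs : ‖a‖ + ‖b‖ ≤ (1 - ‖q‖) / 2) :
    qPochC a q * qPochC (-a) q * ∑' k, tq (q ^ 2) (a ^ 2) 0 k = 1 := by
  have hq2 : ‖q ^ 2‖ < 1 := by
    rw [norm_pow]; exact pow_lt_one₀ (norm_nonneg _) hq (by norm_num)
  rw [poch_sq q a hq, qbinom (q ^ 2) (a ^ 2) 0 hq2]
  · simp [qPochC]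
  · rw [norm_pow, norm_pow]
    simp only [norm_zero, add_zero]
    nlinarith [norm_nonneg a, norm_nonneg b, norm_nonneg q]

lemma cf_ident (q a b : ℂ) (hq : ‖q‖ < 1) (hs : ‖a‖ + ‖b‖ ≤ (1 - ‖q‖) / 2)
    (x : ℕ → ℂ × ℂ) (hx : ∀ n, x (n + 1) = ((x n).2,
      bC q (n + 1) * (x n).2 + cC q a b (n + 1) * (x n).1)) (n : ℕ) :
    ((x 0).2 * phiq q a b 0 + cC q a b 1 * (x 0).1 * phiq q a b 1 / (1 - q)) *
        ∏ j ∈ Finset.range n, (1 - q * (q ^ 2) ^ j) =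
      (x n).2 * phiq q a b n +
        cC q a b (n + 1) * (x n).1 * phiq q a b (n + 1) / (1 - q ^ (2 * n + 1)) := by
  induction n with
  | zero => simp
  | succ n ih =>
    rw [Finset.prod_range_succ, ← mul_assoc, ih, hx n, phiq_rec q a b hq hs n, bC_succ]
    have h1 := one_sub_pow_ne q hq (2 * n)
    have h2 := one_sub_pow_ne q hq (2 * n + 2)
    have e : q * (q ^ 2) ^ n = q ^ (2 * n + 1) := by rw [← pow_mul]; ring
    have e2 : 2 * (n + 1) + 1 = 2 * n + 2 + 1 := by ring
    have e3 : 2 * n + 3 = 2 * n + 2 + 1 := by ring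
    rw [e, e2, e3]
    simp only
    generalize q ^ (2 * n + 2 + 1) = A at *
    generalize q ^ (2 * n + 1) = B at *
    field_simp
    ring

lemma cf_lim (q a b : ℂ) (hq : ‖q‖ < 1) (hs : ‖a‖ + ‖b‖ ≤ (1 - ‖q‖) / 2)
    (x : ℕ → ℂ × ℂ) (hx : ∀ n, x (n + 1) = ((x n).2,
      bC q (n + 1) * (x n).2 + cC q a b (n + 1) * (x n).1)) (L : ℂ)
    (hL : Tendsto (fun n => (x n).2) atTop (nhds L)) :
    ((x 0).2 * phiq q a b 0 + (x 0).1 * ((a - b) / (1 - q) * phiq q a b 1)) *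
      (qPochC a q * qPochC (-a) q) * qPochC q (q ^ 2) = L := by
  have hq2 : ‖q ^ 2‖ < 1 := by
    rw [norm_pow]; exact pow_lt_one₀ (norm_nonneg _) hq (by norm_num)
  have hp := phi_lim q a b hq hs
  have hL1 : Tendsto (fun n => (x n).1) atTop (nhds L) := by
    rw [← tendsto_add_atTop_iff_nat 1]
    simpa [hx] using hL
  have hc : Tendsto (fun n => cC q a b (n + 1)) atTop (nhds 0) := by
    refine squeeze_zero_norm (cC_bound q a b _ le_rfl hq) ?_
    have := (tendsto_pow_atTop_nhds_zero_of_lt_one (r := max ‖q‖ (1 / 2)) (by positivity)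
      (max_lt hq (by norm_num))).const_mul (2 * (‖a‖ + ‖b‖) ^ 2 + (‖a‖ + ‖b‖) + 1)
    simpa using this
  have hqt : Tendsto (fun n : ℕ => q ^ (2 * n + 1)) atTop (nhds 0) :=
    (tendsto_pow_atTop_nhds_zero_of_norm_lt_one hq).comp
      (tendsto_atTop_mono (f := fun n => n) (fun n => by omega) tendsto_id)
  have r := (hL.mul hp).add (((hc.mul hL1).mul (hp.comp (tendsto_add_atTop_nat 1))).div
    (hqt.const_sub 1) (by simp))
  have l := (qPoch_tendsto q (q ^ 2) hq2).const_mul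
    ((x 0).2 * phiq q a b 0 + cC q a b 1 * (x 0).1 * phiq q a b 1 / (1 - q))
  simp_rw [cf_ident q a b hq hs x hx] at l
  have := tendsto_nhds_unique l r
  rw [cC_one] at this
  have h1 := phi_lim_eq q a b hq hs
  simp only [zero_mul, zero_div, add_zero] at this
  linear_combination (qPochC a q * qPochC (-a) q) * this + L * h1

lemma small_case (q a b : ℂ) (hq : ‖q‖ < 1) (hs : ‖a‖ + ‖b‖ ≤ (1 - ‖q‖) / 2) (P Q : ℂ)
    (hP : Tendsto (fun n => (cfNumC (cC q a b) (bC q) n).2) atTop (nhds P))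
    (hQ : Tendsto (fun n => (cfDenC (cC q a b) (bC q) n).2) atTop (nhds Q)) :
    (qPochC (-a) q * qPochC b q - qPochC a q * qPochC (-b) q) * qPochC q (q ^ 2) = 2 * P ∧
    (qPochC (-a) q * qPochC b q + qPochC a q * qPochC (-b) q) * qPochC q (q ^ 2) = 2 * Q := by
  have h1 := cf_lim q a b hq hs _ (fun n => rfl) P hP
  have h2 := cf_lim q a b hq hs _ (fun n => rfl) Q hQ
  have e1 := qbinom q a b hq hs
  have e2 := qbinom q (-a) (-b) hq (by simpa using hs)
  rw [← phi_sum q a b hq hs] at e1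
  rw [← phi_diff q a b hq hs] at e2
  simp only [cfNumC, cfDenC] at h1 h2
  rw [← e1, ← e2]
  constructor
  · linear_combination 2 * h1
  · linear_combination 2 * h2

/-- Ramanujan's continued fraction for
`((-a;q)∞ (b;q)∞ - (a;q)∞ (-b;q)∞) / ((-a;q)∞ (b;q)∞ + (a;q)∞ (-b;q)∞)`. -/
theorem stmt_0 (q a b : ℂ) (hq : ‖q‖ < 1)
    (hden : qPochC (-a) q * qPochC b q + qPochC a q * qPochC (-b) q ≠ 0) :
    CFTendstoC
      (fun n => if n = 1 then a - b
        else q ^ (n - 2) * (a - b * q ^ (n - 1)) * (a * q ^ (n - 1) - b))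
      (fun n => 1 - q ^ (2 * n - 1))
      ((qPochC (-a) q * qPochC b q - qPochC a q * qPochC (-b) q) /
        (qPochC (-a) q * qPochC b q + qPochC a q * qPochC (-b) q)) := by
  change CFTendstoC (cC q a b) (bC q) _
  obtain ⟨P, hPd, hP⟩ := cf_entire q a b hq
    (fun z => cfNumC (cC q (a * z) (b * z)) (bC q)) (1, 0) (fun z => rfl)
    (by simp [Prod.norm_def]) (fun z n => rfl)
  obtain ⟨Q, hQd, hQ⟩ := cf_entire q a b hq
    (fun z => cfDenC (cC q (a * z) (b * z)) (bC q)) (0, 1) (fun z => rfl)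
    (by simp [Prod.norm_def]) (fun z n => rfl)
  have hD : qPochC q (q ^ 2) ≠ 0 := by
    refine qPoch_ne_zero _ _ ?_ fun n => ?_
    · rw [norm_pow]; exact pow_lt_one₀ (norm_nonneg _) hq (by norm_num)
    · have := one_sub_pow_ne q hq (2 * n)
      rwa [pow_succ', pow_mul] at this
  have hsmall : ∀ᶠ z : ℂ in nhds 0, ‖a * z‖ + ‖b * z‖ ≤ (1 - ‖q‖) / 2 := by
    have : Tendsto (fun z : ℂ => ‖a * z‖ + ‖b * z‖) (nhds 0) (nhds 0) := by
      have hc : Continuous (fun z : ℂ => ‖a * z‖ + ‖b * z‖) := by fun_prop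
      simpa using hc.tendsto 0
    exact this.eventually_le_const (by linarith)
  have d1 := qPoch_differentiable a q hq
  have d2 := qPoch_differentiable (-a) q hq
  have d3 := qPoch_differentiable b q hq
  have d4 := qPoch_differentiable (-b) q hq
  have an : ∀ f : ℂ → ℂ, Differentiable ℂ f → AnalyticOnNhd ℂ f Set.univ :=
    fun f hf z _ => hf.analyticAt z
  have i1 := AnalyticOnNhd.eq_of_eventuallyEq (z₀ := (0 : ℂ))
    (f := fun z => (qPochC (-a * z) q * qPochC (b * z) q - qPochC (a * z) q * qPochC (-b * z) q)
      * qPochC q (q ^ 2)) (g := fun z => 2 * P z)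
    (an _ (by fun_prop)) (an _ (by fun_prop)) (by
      filter_upwards [hsmall] with z hz
      have := (small_case q (a * z) (b * z) hq hz _ _ (hP z) (hQ z)).1
      simpa only [neg_mul] using this)
  have i2 := AnalyticOnNhd.eq_of_eventuallyEq (z₀ := (0 : ℂ))
    (f := fun z => (qPochC (-a * z) q * qPochC (b * z) q + qPochC (a * z) q * qPochC (-b * z) q)
      * qPochC q (q ^ 2)) (g := fun z => 2 * Q z)
    (an _ (by fun_prop)) (an _ (by fun_prop)) (by
      filter_upwards [hsmall] with z hz
      have := (small_case q (a * z) (b * z) hq hz _ _ (hP z) (hQ z)).2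
      simpa only [neg_mul] using this)
  have j1 := congrFun i1 1
  have j2 := congrFun i2 1
  have hP1 := hP 1
  have hQ1 := hQ 1
  simp only [mul_one] at j1 j2 hP1 hQ1
  have hQ0 : Q 1 ≠ 0 := by
    intro h
    rw [h, mul_zero] at j2
    exact mul_ne_zero hden hD j2
  have := hP1.div hQ1 hQ0
  unfold CFTendstoC
  suffices hv : (qPochC (-a) q * qPochC b q - qPochC a q * qPochC (-b) q) /
        (qPochC (-a) q * qPochC b q + qPochC a q * qPochC (-b) q) = P 1 / Q 1 by
    rw [hv]; exact this
  rw [div_eq_div_iff hden hQ0]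
  refine mul_right_cancel₀ (mul_ne_zero two_ne_zero hD) ?_
  linear_combination (2 * Q 1) * j1 - 2 * P 1 * j2
end

section
/- Let q be real with 0 < q < 1, and set f(−q) = (q;q)_∞ and Φ(−q) = (−q;q)_∞. Then the continued fraction with partial numerators cₙ = q^{2n−1} and partial denominators bₙ = 1 − q^{2n−1} for n ≥ 1 (that is, q/(1−q + q³/(1−q³ + q⁵/(1−q⁵ + q⁷/(1−q⁷ + ⋯))))) converges, and its value equals (Φ(−q) − f(−q))/(Φ(−q) + f(−q)). -/
open Filter

/-- Numerator pairs `(p_{n-1}, p_n)` of the continued fraction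
`c 1 / (b 1 + c 2 / (b 2 + ⋯))` (indices start at 1). -/
noncomputable def cfNum (c b : ℕ → ℝ) : ℕ → ℝ × ℝ
  | 0 => (1, 0)
  | n + 1 => ((cfNum c b n).2, b (n + 1) * (cfNum c b n).2 + c (n + 1) * (cfNum c b n).1)

/-- Denominator pairs `(q_{n-1}, q_n)` of the continued fraction. -/
noncomputable def cfDen (c b : ℕ → ℝ) : ℕ → ℝ × ℝ
  | 0 => (0, 1)
  | n + 1 => ((cfDen c b n).2, b (n + 1) * (cfDen c b n).2 + c (n + 1) * (cfDen c b n).1)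

/-- The continued fraction with partial numerators `c` and partial denominators `b`
(both indexed from 1) converges to `L`, i.e. its convergents tend to `L`. -/
def CFTendsto (c b : ℕ → ℝ) (L : ℝ) : Prop :=
  Tendsto (fun n => (cfNum c b n).2 / (cfDen c b n).2) atTop (nhds L)
/-- The q-Pochhammer infinite product `(a; q)_∞ = ∏_{n=0}^∞ (1 - a qⁿ)`. -/
noncomputable def qPoch (a q : ℝ) : ℝ := ∏' n : ℕ, (1 - a * q ^ n)

/-- Auxiliary coefficients `(-1)^s (-1;q)_s/(q;q)_s`. -/
noncomputable def auxT (q : ℝ) : ℕ → ℝ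
  | 0 => 1
  | s + 1 => -(auxT q s * (1 + q ^ s)) / (1 - q ^ (s + 1))

/-- Partial products of `(q;q)/(-q;q)`. -/
noncomputable def auxP (q : ℝ) : ℕ → ℝ
  | 0 => 1
  | n + 1 => auxP q n * ((1 - q ^ (n + 1)) / (1 + q ^ (n + 1)))

/-- The Shanks-type finite sums. -/
noncomputable def auxB (q : ℝ) (n : ℕ) : ℝ :=
  ∑ s ∈ Finset.range (n + 1), auxT q s * q ^ (s * (n + 1))

lemma aux_pos {q : ℝ} (hq0 : 0 < q) (hq1 : q < 1) (n : ℕ) : 0 < 1 - q ^ (n + 1) :=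
  sub_pos.2 (pow_lt_one₀ hq0.le hq1 (by omega))

lemma auxT_succ {q : ℝ} (hq0 : 0 < q) (hq1 : q < 1) (s : ℕ) :
    auxT q (s + 1) * (1 - q ^ (s + 1)) = -(auxT q s * (1 + q ^ s)) := by
  have := aux_pos hq0 hq1 s
  rw [auxT]
  field_simp

lemma auxP_succ {q : ℝ} (hq0 : 0 < q) (n : ℕ) :
    auxP q (n + 1) * (1 + q ^ (n + 1)) = auxP q n * (1 - q ^ (n + 1)) := by
  have : 0 < 1 + q ^ (n + 1) := by positivity
  rw [auxP]
  field_simp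

lemma auxPT {q : ℝ} (hq0 : 0 < q) (hq1 : q < 1) (n : ℕ) :
    auxP q n * (auxT q (n + 1) * (1 - q ^ (n + 1))) = 2 * (-1) ^ (n + 1) := by
  induction n with
  | zero => rw [auxT_succ hq0 hq1]; simp [auxP, auxT]; norm_num
  | succ n ih =>
    rw [auxT_succ hq0 hq1]
    have h := auxP_succ hq0 n
    rw [pow_succ (-1 : ℝ) (n + 1)]
    linear_combination (-1) * ih - auxT q (n + 1) * h

lemma aux_tele {q : ℝ} (hq0 : 0 < q) (hq1 : q < 1) (n N : ℕ) :
    (1 - q ^ n) * ∑ s ∈ Finset.range N, auxT q s * q ^ (s * (n + 1))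
      - (1 + q ^ n) * ∑ s ∈ Finset.range N, auxT q s * q ^ (s * n)
      = auxT q N * (1 - q ^ N) * q ^ (N * n) := by
  induction N with
  | zero => simp
  | succ N ih =>
    rw [Finset.sum_range_succ, Finset.sum_range_succ, auxT_succ hq0 hq1]
    have e1 : q ^ (N * (n + 1)) = q ^ (N * n) * q ^ N := by rw [← pow_add]; ring_nf
    have e2 : q ^ ((N + 1) * n) = q ^ (N * n) * q ^ n := by rw [← pow_add]; ring_nf
    rw [e1, e2]
    linear_combination ih

lemma auxB_succ {q : ℝ} (hq0 : 0 < q) (hq1 : q < 1) (n : ℕ) :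
    auxP q (n + 1) * auxB q (n + 1) - auxP q n * auxB q n
      = 2 * ((-1) ^ (n + 1) * q ^ ((n + 1) ^ 2)) := by
  have h1 := aux_tele hq0 hq1 (n + 1) (n + 1)
  have hB : auxB q (n + 1) = ∑ s ∈ Finset.range (n + 1), auxT q s * q ^ (s * (n + 1 + 1))
      + auxT q (n + 1) * q ^ ((n + 1) ^ 2) * q ^ (n + 1) := by
    rw [auxB, Finset.sum_range_succ, mul_assoc, ← pow_add]
    congr 3
    ring
  have hB' : auxB q n = ∑ s ∈ Finset.range (n + 1), auxT q s * q ^ (s * (n + 1)) := rfl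
  rw [← hB', ← pow_two] at h1
  have h2 := auxP_succ hq0 n
  have h3 := auxPT hq0 hq1 n
  have h4 : (0 : ℝ) < 1 + q ^ (n + 1) := by positivity
  apply mul_left_cancel₀ h4.ne'
  generalize ∑ s ∈ Finset.range (n + 1), auxT q s * q ^ (s * (n + 1 + 1)) = X at *
  rw [hB]
  linear_combination (X + auxT q (n + 1) * q ^ ((n + 1) ^ 2) * q ^ (n + 1)) * h2
    + auxP q n * h1 + q ^ ((n + 1) ^ 2) * (1 + q ^ (n + 1)) * h3

lemma auxT_bound {q : ℝ} (hq0 : 0 < q) (hq1 : q < 1) (s : ℕ) :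
    |auxT q s| ≤ (2 / (1 - q)) ^ s := by
  induction s with
  | zero => simp [auxT]
  | succ s ih =>
    have h1 : 0 < 1 - q := by linarith
    have h2 : q ^ (s + 1) ≤ q := pow_le_of_le_one hq0.le hq1.le (by omega)
    have h3 : q ^ s ≤ 1 := pow_le_one₀ hq0.le hq1.le
    have h4 : (0 : ℝ) < 1 + q ^ s := by positivity
    have h5 := aux_pos hq0 hq1 s
    rw [auxT, abs_div, abs_neg, abs_mul, abs_of_pos h4, abs_of_pos h5, mul_div_assoc,
      pow_succ (2 / (1 - q)) s]
    have h6 : (1 + q ^ s) / (1 - q ^ (s + 1)) ≤ 2 / (1 - q) :=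
      div_le_div₀ (by norm_num) (by linarith) h1 (by linarith)
    exact mul_le_mul ih h6 (by positivity) (by positivity)

lemma auxB_tendsto {q : ℝ} (hq0 : 0 < q) (hq1 : q < 1) :
    Tendsto (auxB q) atTop (nhds 1) := by
  set M := 2 / (1 - q) with hM
  have hMp : 0 < M := div_pos two_pos (by linarith)
  have hx : Tendsto (fun n : ℕ => M * q ^ (n + 1)) atTop (nhds 0) := by
    have := (tendsto_pow_atTop_nhds_zero_of_lt_one hq0.le hq1).comp (tendsto_add_atTop_nat 1)
    simpa using this.const_mul M
  have hb : Tendsto (fun n : ℕ => (M * q) * (n * q ^ n)) atTop (nhds 0) := by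
    simpa using (tendsto_self_mul_const_pow_of_lt_one hq0.le hq1).const_mul (M * q)
  rw [tendsto_iff_norm_sub_tendsto_zero]
  refine squeeze_zero' (Eventually.of_forall fun n => norm_nonneg _) ?_ hb
  filter_upwards [hx.eventually (gt_mem_nhds one_pos)] with n hn
  have e : auxB q n - 1 = ∑ s ∈ Finset.range n, auxT q (s + 1) * q ^ ((s + 1) * (n + 1)) := by
    rw [auxB, Finset.sum_range_succ']
    simp [auxT]
  rw [e]
  calc _ ≤ ∑ s ∈ Finset.range n, M * q ^ (n + 1) := by
        refine norm_sum_le_of_le _ fun s _ => ?_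
        rw [Real.norm_eq_abs, abs_mul, abs_of_pos (pow_pos hq0 _)]
        calc _ ≤ M ^ (s + 1) * q ^ ((s + 1) * (n + 1)) := by
              gcongr
              exact auxT_bound hq0 hq1 _
          _ = (M * q ^ (n + 1)) ^ (s + 1) := by
              rw [mul_pow, ← pow_mul, mul_comm (s + 1)]
          _ ≤ _ := pow_le_of_le_one (by positivity) hn.le (by omega)
    _ = _ := by
        rw [Finset.sum_const, Finset.card_range, nsmul_eq_mul]; ring

lemma aux_mult {q : ℝ} (hq0 : 0 < q) (hq1 : q < 1) (a : ℝ) :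
    Tendsto (fun n => ∏ k ∈ Finset.range n, (1 - a * q ^ k)) atTop (nhds (qPoch a q)) := by
  have h : Multipliable fun k : ℕ => 1 + (-a * q ^ k) := by
    apply Real.multipliable_one_add_of_summable
    exact (summable_geometric_of_lt_one hq0.le hq1).mul_left _
  have := h.tendsto_prod_tprod_nat
  simpa [qPoch, sub_eq_add_neg] using this

lemma auxP_eq (q : ℝ) (n : ℕ) : auxP q n =
    (∏ k ∈ Finset.range n, (1 - q * q ^ k)) / ∏ k ∈ Finset.range n, (1 - (-q) * q ^ k) := by
  induction n with
  | zero => simp [auxP]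
  | succ n ih =>
    rw [auxP, ih, Finset.prod_range_succ, Finset.prod_range_succ, div_mul_div_comm]
    ring_nf

lemma aux_num {q : ℝ} (n : ℕ) :
    (cfNum (fun n => q ^ (2 * n - 1)) (fun n => 1 - q ^ (2 * n - 1)) n).2
      - (cfNum (fun n => q ^ (2 * n - 1)) (fun n => 1 - q ^ (2 * n - 1)) n).1
      = (-1) ^ (n + 1) * q ^ (n ^ 2) := by
  induction n with
  | zero => simp [cfNum]
  | succ n ih =>
    simp only [cfNum]
    have e : q ^ ((n + 1) ^ 2) = q ^ (n ^ 2) * q ^ (2 * (n + 1) - 1) := by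
      rw [← pow_add]; congr 1
      have : 2 * (n + 1) - 1 = 2 * n + 1 := by omega
      rw [this]; ring
    rw [e, pow_succ (-1 : ℝ) (n + 1)]
    linear_combination (-q ^ (2 * (n + 1) - 1)) * ih

lemma aux_den {q : ℝ} (n : ℕ) :
    cfDen (fun n => q ^ (2 * n - 1)) (fun n => 1 - q ^ (2 * n - 1)) n
      = (1 - (cfNum (fun n => q ^ (2 * n - 1)) (fun n => 1 - q ^ (2 * n - 1)) n).1,
        1 - (cfNum (fun n => q ^ (2 * n - 1)) (fun n => 1 - q ^ (2 * n - 1)) n).2) := by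
  induction n with
  | zero => simp [cfNum, cfDen]
  | succ n ih =>
    simp only [cfNum, cfDen, ih]
    ext
    · simp
    · simp only; ring

lemma aux_main {q : ℝ} (hq0 : 0 < q) (hq1 : q < 1) (n : ℕ) :
    (cfNum (fun n => q ^ (2 * n - 1)) (fun n => 1 - q ^ (2 * n - 1)) n).2
      = (1 - auxP q n * auxB q n) / 2 := by
  induction n with
  | zero => simp [cfNum, auxP, auxB, auxT]
  | succ n ih =>
    have h1 := aux_num (q := q) (n + 1)
    have h2 := auxB_succ hq0 hq1 n
    have h3 : (cfNum (fun n => q ^ (2 * n - 1)) (fun n => 1 - q ^ (2 * n - 1)) (n + 1)).1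
      = (cfNum (fun n => q ^ (2 * n - 1)) (fun n => 1 - q ^ (2 * n - 1)) n).2 := rfl
    rw [h3, ih, pow_succ (-1 : ℝ) (n + 1)] at h1
    linear_combination h1 + h2 / 2

/-- Proposition 2: `(Φ(-q) - f(-q))/(Φ(-q) + f(-q)) = q/(1-q +) q³/(1-q³ +) q⁵/(1-q⁵ +) ⋯`
where `f(-q) = (q;q)_∞` and `Φ(-q) = (-q;q)_∞`. -/
theorem stmt_2 (q : ℝ) (hq0 : 0 < q) (hq1 : q < 1) :
    CFTendsto
      (fun n => q ^ (2 * n - 1))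
      (fun n => 1 - q ^ (2 * n - 1))
      ((qPoch (-q) q - qPoch q q) / (qPoch (-q) q + qPoch q q)) := by
  have hf := aux_mult hq0 hq1 q
  have hP := aux_mult hq0 hq1 (-q)
  have hP1 : 1 ≤ qPoch (-q) q := by
    refine ge_of_tendsto' hP fun n => ?_
    refine (Finset.prod_const_one (s := Finset.range n)).symm.le.trans ?_
    refine Finset.prod_le_prod (fun _ _ => zero_le_one) fun k _ => ?_
    have : 0 < q * q ^ k := by positivity
    simp only [neg_mul, sub_neg_eq_add]
    linarith
  have hf0 : 0 ≤ qPoch q q := by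
    refine ge_of_tendsto' hf fun n => ?_
    refine Finset.prod_nonneg fun k _ => ?_
    have := aux_pos hq0 hq1 k
    rw [pow_succ'] at this
    exact this.le
  have hPp : 0 < qPoch (-q) q := by linarith
  have hT : Tendsto (fun n => auxP q n * auxB q n) atTop
      (nhds (qPoch q q / qPoch (-q) q)) := by
    have := (hf.div hP hPp.ne').mul (auxB_tendsto hq0 hq1)
    rw [mul_one] at this
    refine this.congr fun n => ?_
    rw [auxP_eq]; rfl
  have hd : (1 + qPoch q q / qPoch (-q) q) ≠ 0 := by positivity
  have key := (hT.const_sub 1).div (hT.const_add 1) hd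
  unfold CFTendsto
  have e : (qPoch (-q) q - qPoch q q) / (qPoch (-q) q + qPoch q q)
      = (1 - qPoch q q / qPoch (-q) q) / (1 + qPoch q q / qPoch (-q) q) := by
    have : 0 < qPoch (-q) q + qPoch q q := by linarith
    field_simp
  rw [e]
  refine key.congr fun n => ?_
  rw [aux_den]
  simp only [Pi.div_apply]
  rw [aux_main hq0 hq1]
  have e2 : 1 - (1 - auxP q n * auxB q n) / 2 = (1 + auxP q n * auxB q n) / 2 := by ring
  rw [e2, div_div_div_cancel_right₀ two_ne_zero]
end

section
/- Let q and a be complex numbers with |q| < 1 and a²·q^{2n} ≠ 1 for every integer n ≥ 0. Then the continued fraction with partial numerators c₁ = 1 and c_{n+1} = −a²·q^{n−1}·(1 − qⁿ)² for n ≥ 1, and partial denominators bₙ = 1 − q^{2n−1} (that is, 1/(1−q + (−a²(1−q)²)/(1−q³ + (−qa²(1−q²)²)/(1−q⁵ + (−q²a²(1−q³)²)/(1−q⁷ + ⋯))))) converges, and its value equals ∑_{n=0}^{∞} qⁿ/(1 − a²·q^{2n}). -/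
open Filter

namespace QCF

/-- partial numerators, with parameter `x = a ^ 2` -/
noncomputable def cc (q x : ℂ) (n : ℕ) : ℂ :=
  if n = 1 then 1 else -x * q ^ (n - 2) * (1 - q ^ (n - 1)) ^ 2

/-- partial denominators -/
noncomputable def bb (q : ℂ) (n : ℕ) : ℂ := 1 - q ^ (2 * n - 1)

/-- general solution of the recurrence -/
noncomputable def gen (q : ℂ) (y : ℂ × ℂ) (x : ℂ) : ℕ → ℂ × ℂ
  | 0 => y
  | n + 1 => ((gen q y x n).2,
      bb q (n + 1) * (gen q y x n).2 + cc q x (n + 1) * (gen q y x n).1)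

lemma num_eq (q x : ℂ) (n : ℕ) : cfNumC (cc q x) (bb q) n = gen q (1, 0) x n := by
  induction n with
  | zero => rfl
  | succ n ih => simp only [cfNumC, gen, ih]

lemma den_eq (q x : ℂ) (n : ℕ) : cfDenC (cc q x) (bb q) n = gen q (0, 1) x n := by
  induction n with
  | zero => rfl
  | succ n ih => simp only [cfDenC, gen, ih]

lemma bb_succ (q : ℂ) (n : ℕ) : bb q (n + 1) = 1 - q ^ (2 * n + 1) := by
  simp only [bb]; congr 2

lemma cc_one (q x : ℂ) : cc q x 1 = 1 := by simp [cc]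

lemma cc_succ (q x : ℂ) (n : ℕ) :
    cc q x (n + 2) = -x * q ^ n * (1 - q ^ (n + 1)) ^ 2 := by
  simp [cc]

lemma gen_succ1 (q : ℂ) (y : ℂ × ℂ) (x : ℂ) (n : ℕ) :
    (gen q y x (n + 1)).1 = (gen q y x n).2 := rfl

lemma gen_succ2 (q : ℂ) (y : ℂ × ℂ) (x : ℂ) (n : ℕ) :
    (gen q y x (n + 1)).2 =
      bb q (n + 1) * (gen q y x n).2 + cc q x (n + 1) * (gen q y x n).1 := rfl

lemma den_shift (q x : ℂ) (n : ℕ) :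
    (1 - q ^ n * x) * (gen q (0, 1) x n).2 + cc q x (n + 1) * (gen q (0, 1) x n).1
      = (1 - x) * (gen q (0, 1) (q ^ 2 * x) n).2 := by
  induction n using Nat.twoStepInduction with
  | zero => simp [gen]
  | one => simp [gen, cc_one, cc_succ, bb_succ]; ring
  | more n h1 h2 =>
    simp only [gen_succ1, gen_succ2, cc_succ, bb_succ, add_assoc, Nat.reduceAdd] at h1 h2 ⊢
    linear_combination (1 - q ^ (2 * (n + 1) + 1)) * h2 +
      (-(q ^ 2 * x) * q ^ n * (1 - q ^ (n + 1)) ^ 2) * h1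

lemma num_shift (q x : ℂ) (n : ℕ) :
    (1 - q ^ n * x) * (gen q (1, 0) x n).2 + cc q x (n + 1) * (gen q (1, 0) x n).1
      = q * (1 - x) * (gen q (1, 0) (q ^ 2 * x) n).2 + (gen q (0, 1) (q ^ 2 * x) n).2 := by
  induction n using Nat.twoStepInduction with
  | zero => simp [gen, cc_one]
  | one => simp [gen, cc_one, cc_succ, bb_succ]; ring
  | more n h1 h2 =>
    simp only [gen_succ1, gen_succ2, cc_succ, bb_succ, add_assoc, Nat.reduceAdd] at h1 h2 ⊢
    linear_combination (1 - q ^ (2 * (n + 1) + 1)) * h2 +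
      (-(q ^ 2 * x) * q ^ n * (1 - q ^ (n + 1)) ^ 2) * h1

lemma cc_bound (q x : ℂ) (R ρ : ℝ) (hρ : 1 / 2 ≤ ρ) (hρ1 : ρ < 1) (hq : ‖q‖ ≤ ρ)
    (hx : ‖x‖ ≤ R) (n : ℕ) : ‖cc q x (n + 1)‖ ≤ (8 * R + 1) * ρ ^ n := by
  have hR : 0 ≤ R := (norm_nonneg x).trans hx
  rcases n with _ | n
  · simp [cc_one]; linarith
  · rw [cc_succ]
    have h1 : ‖1 - q ^ (n + 1)‖ ≤ 2 := by
      refine (norm_sub_le _ _).trans ?_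
      have : ‖q ^ (n + 1)‖ ≤ 1 := by
        rw [norm_pow]; exact pow_le_one₀ (norm_nonneg _) (hq.trans hρ1.le)
      simp only [norm_one]; linarith
    have h2 : ‖q ^ n‖ ≤ ρ ^ n := by rw [norm_pow]; gcongr
    rw [norm_mul, norm_mul, norm_neg, norm_pow (1 - q ^ (n + 1))]
    have hp : 0 < ρ ^ n := by positivity
    calc ‖x‖ * ‖q ^ n‖ * ‖1 - q ^ (n + 1)‖ ^ 2 ≤ R * ρ ^ n * 2 ^ 2 := by gcongr
      _ ≤ (8 * R + 1) * ρ ^ (n + 1) := by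
        rw [pow_succ ρ n]
        nlinarith [mul_nonneg hR hp.le, mul_nonneg (mul_nonneg hR hp.le) (sub_nonneg.2 hρ),
          mul_pos hp (by linarith : 0 < ρ)]

lemma step_bound (q x : ℂ) (y : ℂ × ℂ) (R ρ : ℝ) (hρ : 1 / 2 ≤ ρ) (hρ1 : ρ < 1) (hq : ‖q‖ ≤ ρ)
    (hx : ‖x‖ ≤ R) (n : ℕ) :
    ‖(gen q y x (n + 1)).2 - (gen q y x n).2‖ ≤ 2 * (8 * R + 1) * ρ ^ n * ‖gen q y x n‖ := by
  have hR : 0 ≤ R := (norm_nonneg x).trans hx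
  have hc := cc_bound q x R ρ hρ hρ1 hq hx n
  have hb : ‖q ^ (2 * n + 1)‖ ≤ (8 * R + 1) * ρ ^ n := by
    rw [norm_pow]
    calc ‖q‖ ^ (2 * n + 1) ≤ ρ ^ (2 * n + 1) := by gcongr
      _ ≤ ρ ^ n := pow_le_pow_of_le_one (by linarith) hρ1.le (by omega)
      _ ≤ _ := le_mul_of_one_le_left (by positivity) (by linarith)
  rw [gen_succ2, bb_succ]
  have h1 := norm_fst_le (gen q y x n)
  have h2 := norm_snd_le (gen q y x n)
  calc _ = ‖cc q x (n + 1) * (gen q y x n).1 - q ^ (2 * n + 1) * (gen q y x n).2‖ := by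
        congr 1; ring
    _ ≤ ‖cc q x (n + 1)‖ * ‖(gen q y x n).1‖ + ‖q ^ (2 * n + 1)‖ * ‖(gen q y x n).2‖ := by
        rw [← norm_mul, ← norm_mul]; exact norm_sub_le _ _
    _ ≤ (8 * R + 1) * ρ ^ n * ‖gen q y x n‖ + (8 * R + 1) * ρ ^ n * ‖gen q y x n‖ := by gcongr
    _ = _ := by ring

lemma gen_bound (q x : ℂ) (y : ℂ × ℂ) (R ρ : ℝ) (hρ : 1 / 2 ≤ ρ) (hρ1 : ρ < 1) (hq : ‖q‖ ≤ ρ)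
    (hx : ‖x‖ ≤ R) (n : ℕ) :
    ‖gen q y x n‖ ≤ ‖y‖ * Real.exp (2 * (8 * R + 1) * (1 - ρ)⁻¹) := by
  have hR : 0 ≤ R := (norm_nonneg x).trans hx
  have key : ‖gen q y x n‖ ≤
      ‖y‖ * Real.exp (2 * (8 * R + 1) * ∑ i ∈ Finset.range n, ρ ^ i) := by
    induction n with
    | zero => simp [gen]
    | succ n ih =>
      have hs := step_bound q x y R ρ hρ hρ1 hq hx n
      set t := 2 * (8 * R + 1) * ρ ^ n with ht
      have ht0 : 0 ≤ t := by positivity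
      have h2 := norm_snd_le (gen q y x n)
      have hle : ‖gen q y x (n + 1)‖ ≤ (t + 1) * ‖gen q y x n‖ := by
        rw [Prod.norm_def]
        apply max_le
        · rw [gen_succ1]; nlinarith [norm_nonneg (gen q y x n)]
        · have := norm_le_norm_add_norm_sub' (gen q y x (n + 1)).2 (gen q y x n).2
          linarith
      rw [Finset.sum_range_succ, mul_add, ← ht, Real.exp_add]
      calc _ ≤ (t + 1) * ‖gen q y x n‖ := hle
        _ ≤ Real.exp t * (‖y‖ * Real.exp (2 * (8 * R + 1) * ∑ i ∈ Finset.range n, ρ ^ i)) := by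
          gcongr; exact Real.add_one_le_exp t
        _ = _ := by ring
  refine key.trans ?_
  have hs : ∑ i ∈ Finset.range n, ρ ^ i ≤ (1 - ρ)⁻¹ := by
    rw [← tsum_geometric_of_lt_one (by linarith) hρ1]
    exact (summable_geometric_of_lt_one (by linarith) hρ1).sum_le_tsum _
      (fun i _ => by positivity)
  gcongr

lemma gen_cont (q : ℂ) (y : ℂ × ℂ) (n : ℕ) :
    Continuous (fun x => (gen q y x n).1) ∧ Continuous (fun x => (gen q y x n).2) := by
  induction n with
  | zero => simp only [gen]; exact ⟨continuous_const, continuous_const⟩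
  | succ n ih =>
    refine ⟨ih.2, ?_⟩
    simp only [gen_succ2]
    have hc : Continuous fun x => cc q x (n + 1) := by
      rcases n with _ | n
      · simp only [zero_add, cc_one]; exact continuous_const
      · simp only [cc_succ]; fun_prop
    exact (continuous_const.mul ih.2).add (hc.mul ih.1)

lemma exists_lim (q : ℂ) (hq : ‖q‖ < 1) (y : ℂ × ℂ) :
    ∃ G : ℂ → ℂ, Continuous G ∧
      ∀ x, Tendsto (fun n => (gen q y x n).2) atTop (nhds (G x)) := by
  set ρ := max ‖q‖ (1 / 2) with hρd
  have hρ : 1 / 2 ≤ ρ := le_max_right _ _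
  have hqρ : ‖q‖ ≤ ρ := le_max_left _ _
  have hρ1 : ρ < 1 := max_lt hq (by norm_num)
  have bound : ∀ R x, ‖x‖ ≤ R → ∀ n, ‖(gen q y x (n + 1)).2 - (gen q y x n).2‖ ≤
      2 * (8 * R + 1) * (‖y‖ * Real.exp (2 * (8 * R + 1) * (1 - ρ)⁻¹)) * ρ ^ n := by
    intro R x hx n
    have hR : 0 ≤ R := (norm_nonneg x).trans hx
    refine (step_bound q x y R ρ hρ hρ1 hqρ hx n).trans ?_
    have := gen_bound q x y R ρ hρ hρ1 hqρ hx n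
    calc _ ≤ 2 * (8 * R + 1) * ρ ^ n * (‖y‖ * Real.exp (2 * (8 * R + 1) * (1 - ρ)⁻¹)) := by
          gcongr
      _ = _ := by ring
  have summ : ∀ R, Summable fun n : ℕ =>
      2 * (8 * R + 1) * (‖y‖ * Real.exp (2 * (8 * R + 1) * (1 - ρ)⁻¹)) * ρ ^ n := fun R =>
    (summable_geometric_of_lt_one (by linarith) hρ1).mul_left _
  refine ⟨fun x => y.2 + ∑' n, ((gen q y x (n + 1)).2 - (gen q y x n).2), ?_, ?_⟩
  · rw [continuous_iff_continuousAt]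
    intro x
    have : ContinuousOn (fun x => ∑' n, ((gen q y x (n + 1)).2 - (gen q y x n).2))
        (Metric.closedBall 0 (‖x‖ + 1)) := by
      refine continuousOn_tsum (fun n => ?_) (summ (‖x‖ + 1)) (fun n z hz => ?_)
      · exact ((gen_cont q y (n + 1)).2.sub (gen_cont q y n).2).continuousOn
      · exact bound _ z (by simpa using hz) n
    refine continuousAt_const.add (this.continuousAt ?_)
    exact Metric.closedBall_mem_nhds_of_mem (by simp)
  · intro x
    have hs : Summable fun n => ((gen q y x (n + 1)).2 - (gen q y x n).2) :=
      Summable.of_norm_bounded (summ ‖x‖) (bound ‖x‖ x le_rfl)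
    have := hs.hasSum.tendsto_sum_nat.const_add y.2
    refine this.congr (fun n => ?_)
    rw [Finset.sum_range_sub (fun n => (gen q y x n).2)]
    simp [gen]

lemma cc_tendsto (q x : ℂ) (hq : ‖q‖ < 1) :
    Tendsto (fun n => cc q x (n + 1)) atTop (nhds 0) := by
  set ρ := max ‖q‖ (1 / 2) with hρd
  have hρ : 1 / 2 ≤ ρ := le_max_right _ _
  have hqρ : ‖q‖ ≤ ρ := le_max_left _ _
  have hρ1 : ρ < 1 := max_lt hq (by norm_num)
  refine squeeze_zero_norm (cc_bound q x ‖x‖ ρ hρ hρ1 hqρ le_rfl) ?_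
  simpa using (tendsto_pow_atTop_nhds_zero_of_lt_one (by linarith) hρ1).const_mul (8 * ‖x‖ + 1)

lemma left_lim (q : ℂ) (hq : ‖q‖ < 1) (y : ℂ × ℂ) (x g : ℂ)
    (h : Tendsto (fun n => (gen q y x n).2) atTop (nhds g)) :
    Tendsto (fun n => (1 - q ^ n * x) * (gen q y x n).2 + cc q x (n + 1) * (gen q y x n).1)
      atTop (nhds g) := by
  have h1 : Tendsto (fun n => (gen q y x n).1) atTop (nhds g) := by
    rw [← tendsto_add_atTop_iff_nat 1]; exact h
  have hp := tendsto_pow_atTop_nhds_zero_of_norm_lt_one hq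
  have := (((hp.mul_const x).const_sub 1).mul h).add ((cc_tendsto q x hq).mul h1)
  simpa using this

lemma den_zero (q : ℂ) (n : ℕ) :
    (gen q (0, 1) 0 n).2 = ∏ i ∈ Finset.range n, (1 + -q ^ (2 * i + 1)) := by
  induction n with
  | zero => simp [gen]
  | succ n ih =>
    rw [gen_succ2, ih, Finset.prod_range_succ, bb_succ]
    rcases n with _ | n
    · simp [gen]; ring
    · rw [cc_succ]; ring

lemma den_zero_lim (q : ℂ) (hq : ‖q‖ < 1) (g : ℂ)
    (h : Tendsto (fun n => (gen q (0, 1) 0 n).2) atTop (nhds g)) : g ≠ 0 := by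
  have hs : Summable fun i : ℕ => ‖-q ^ (2 * i + 1)‖ := by
    refine Summable.of_nonneg_of_le (fun _ => norm_nonneg _) (fun i => ?_)
      (summable_geometric_of_lt_one (norm_nonneg q) hq)
    rw [norm_neg, norm_pow]
    exact pow_le_pow_of_le_one (norm_nonneg _) hq.le (by omega)
  have hne : ∀ i : ℕ, 1 + -q ^ (2 * i + 1) ≠ 0 := by
    intro i hi
    have : q ^ (2 * i + 1) = 1 := by linear_combination -hi
    have h2 : ‖q‖ ^ (2 * i + 1) = 1 := by rw [← norm_pow, this, norm_one]
    have := pow_lt_one₀ (norm_nonneg q) hq (n := 2 * i + 1) (by omega)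
    linarith
  have hm := multipliable_one_add_of_summable hs
  have ht := hm.hasProd.tendsto_prod_nat
  simp only [den_zero] at h
  rw [tendsto_nhds_unique h ht]
  exact tprod_one_add_ne_zero_of_summable hne hs

lemma main (q x : ℂ) (hq : ‖q‖ < 1) (hx : ∀ n : ℕ, x * q ^ (2 * n) ≠ 1) :
    Tendsto (fun n => (gen q (1, 0) x n).2 / (gen q (0, 1) x n).2) atTop
      (nhds (∑' n : ℕ, q ^ n / (1 - x * q ^ (2 * n)))) := by
  obtain ⟨P, hPc, hP⟩ := exists_lim q hq (1, 0)
  obtain ⟨Q, hQc, hQ⟩ := exists_lim q hq (0, 1)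
  have hQ0 : Q 0 ≠ 0 := den_zero_lim q hq _ (hQ 0)
  have fQ : ∀ x, Q x = (1 - x) * Q (q ^ 2 * x) := fun x => by
    have h1 := left_lim q hq _ x _ (hQ x)
    simp only [den_shift] at h1
    exact tendsto_nhds_unique h1 ((hQ _).const_mul _)
  have fP : ∀ x, P x = q * (1 - x) * P (q ^ 2 * x) + Q (q ^ 2 * x) := fun x => by
    have h1 := left_lim q hq _ x _ (hP x)
    simp only [num_shift] at h1
    exact tendsto_nhds_unique h1 (((hP _).const_mul _).add (hQ _))
  have hpw : Tendsto (fun n : ℕ => x * q ^ (2 * n)) atTop (nhds 0) := by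
    have h2 : ‖q ^ 2‖ < 1 := by
      rw [norm_pow]; exact pow_lt_one₀ (norm_nonneg q) hq (by norm_num)
    have := (tendsto_pow_atTop_nhds_zero_of_norm_lt_one h2).const_mul x
    simpa [pow_mul] using this
  have hsh : ∀ n : ℕ, q ^ 2 * (x * q ^ (2 * n)) = x * q ^ (2 * (n + 1)) := fun n => by ring
  have hne : ∀ n : ℕ, 1 - x * q ^ (2 * n) ≠ 0 := fun n h => hx n (by linear_combination -h)
  have hQn : ∀ n : ℕ, Q (x * q ^ (2 * n)) ≠ 0 := by
    have hstep : ∀ n : ℕ, Q (x * q ^ (2 * n)) = 0 → Q (x * q ^ (2 * (n + 1))) = 0 := by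
      intro n h
      rw [fQ, hsh] at h
      exact (mul_eq_zero.1 h).resolve_left (hne n)
    intro n h
    have hall : ∀ m ≥ n, Q (x * q ^ (2 * m)) = 0 := by
      intro m hm
      induction m, hm using Nat.le_induction with
      | base => exact h
      | succ m _ ih => exact hstep m ih
    have h1 : Tendsto (fun n : ℕ => Q (x * q ^ (2 * n))) atTop (nhds (Q 0)) :=
      (hQc.tendsto 0).comp hpw
    have h2 : Tendsto (fun n : ℕ => Q (x * q ^ (2 * n))) atTop (nhds 0) :=
      tendsto_const_nhds.congr' (by
        filter_upwards [eventually_ge_atTop n] with m hm using (hall m hm).symm)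
    exact hQ0 (tendsto_nhds_unique h1 h2)
  have hQx : Q x ≠ 0 := by simpa using hQn 0
  have hL : ∀ n : ℕ, P (x * q ^ (2 * n)) / Q (x * q ^ (2 * n)) = 1 / (1 - x * q ^ (2 * n)) +
      q * (P (x * q ^ (2 * (n + 1))) / Q (x * q ^ (2 * (n + 1)))) := by
    intro n
    have h1 := hne n
    have h2 := hQn (n + 1)
    rw [fQ (x * q ^ (2 * n)), fP (x * q ^ (2 * n)), hsh]
    field_simp
    ring
  have hsum : ∀ n : ℕ, ∑ i ∈ Finset.range n, q ^ i / (1 - x * q ^ (2 * i)) =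
      P x / Q x - q ^ n * (P (x * q ^ (2 * n)) / Q (x * q ^ (2 * n))) := by
    intro n
    induction n with
    | zero => simp
    | succ n ih =>
      rw [Finset.sum_range_succ, ih, hL n]
      ring
  have hlim : Tendsto (fun n => ∑ i ∈ Finset.range n, q ^ i / (1 - x * q ^ (2 * i))) atTop
      (nhds (P x / Q x)) := by
    simp only [hsum]
    have h1 := (tendsto_pow_atTop_nhds_zero_of_norm_lt_one hq).mul
      (((hPc.tendsto 0).comp hpw).div ((hQc.tendsto 0).comp hpw) hQ0)
    simpa using h1.const_sub (P x / Q x)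
  have hS : Summable fun n : ℕ => q ^ n / (1 - x * q ^ (2 * n)) := by
    have hinv : Tendsto (fun n : ℕ => (1 - x * q ^ (2 * n))⁻¹) atTop (nhds 1) := by
      simpa using (hpw.const_sub 1).inv₀ (by simp)
    have hO := (Asymptotics.isBigO_refl (fun n : ℕ => q ^ n) atTop).mul (hinv.isBigO_one ℂ)
    refine summable_of_isBigO_nat
      (summable_geometric_of_lt_one (norm_nonneg q) hq) (g := fun n => ‖q‖ ^ n) ?_
    have := hO.norm_right
    simpa [div_eq_mul_inv] using this
  rw [tendsto_nhds_unique hS.hasSum.tendsto_sum_nat hlim]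
  exact (hP x).div (hQ x) hQx

end QCF

/-- Proposition 4: `∑_{n=0}^∞ qⁿ/(1 - a² q^{2n}) =
1/(1-q +) -a²(1-q)²/(1-q³ +) -qa²(1-q²)²/(1-q⁵ +) ⋯`. -/
theorem stmt_4 (q a : ℂ) (hq : ‖q‖ < 1) (ha : ∀ n : ℕ, a ^ 2 * q ^ (2 * n) ≠ 1) :
    CFTendstoC
      (fun n => if n = 1 then 1 else -a ^ 2 * q ^ (n - 2) * (1 - q ^ (n - 1)) ^ 2)
      (fun n => 1 - q ^ (2 * n - 1))
      (∑' n : ℕ, q ^ n / (1 - a ^ 2 * q ^ (2 * n))) := by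
  have h := QCF.main q (a ^ 2) hq ha
  simp only [← QCF.num_eq, ← QCF.den_eq] at h
  exact h
end

section
/- Let r > 0, set q = e^{−π√r}, and assume k_r ∈ (0,1) satisfies K(√(1 − k_r²)) = √r · K(k_r). Then the continued fraction with partial numerators c₁ = 1 and c_{n+1} = q^{n−1}·(1 − qⁿ)² for n ≥ 1, and partial denominators bₙ = 1 − q^{2n−1} (that is, 1/(1−q + (1−q)²/(1−q³ + q(1−q²)²/(1−q⁵ + q²(1−q³)²/(1−q⁷ + ⋯))))) converges, and its value equals K(k_r)/(2π) + 1/4. -/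
open Filter

/-- The complete elliptic integral of the first kind
`K(x) = ∫₀^{π/2} dt / √(1 - x² sin² t)`. -/
noncomputable def Kint (x : ℝ) : ℝ :=
  ∫ t in (0 : ℝ)..(Real.pi / 2), 1 / Real.sqrt (1 - x ^ 2 * Real.sin t ^ 2)


/-- The symmetric (Gauss) form of the complete elliptic integral. -/
noncomputable def gaussI (a b : ℝ) : ℝ :=
  ∫ t in (0 : ℝ)..(Real.pi / 2),
    1 / Real.sqrt (a ^ 2 * Real.cos t ^ 2 + b ^ 2 * Real.sin t ^ 2)

lemma gaussI_pos_aux {a b : ℝ} (ha : 0 < a) (hb : 0 < b) (t : ℝ) :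
    0 < a ^ 2 * Real.cos t ^ 2 + b ^ 2 * Real.sin t ^ 2 := by
  have h := Real.sin_sq_add_cos_sq t
  have h1 : 0 < a ^ 2 := by positivity
  have h2 : 0 < b ^ 2 := by positivity
  rcases (sq_nonneg (Real.sin t)).eq_or_lt with h3 | h3
  · rw [← h3] at h ⊢
    nlinarith
  · nlinarith [mul_pos h2 h3, mul_nonneg h1.le (sq_nonneg (Real.cos t))]

lemma gaussI_pos_aux2 {a b : ℝ} (ha : 0 < a) (hb : 0 < b) (t : ℝ) :
    0 < a * Real.cos t ^ 2 + b * Real.sin t ^ 2 := by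
  have h := gaussI_pos_aux (Real.sqrt_pos.mpr ha) (Real.sqrt_pos.mpr hb) t
  rwa [Real.sq_sqrt ha.le, Real.sq_sqrt hb.le] at h

lemma gaussI_cont {a b : ℝ} (ha : 0 < a) (hb : 0 < b) :
    Continuous (fun t => 1 / Real.sqrt (a ^ 2 * Real.cos t ^ 2 + b ^ 2 * Real.sin t ^ 2)) := by
  refine continuous_const.div (by fun_prop) (fun t => ?_)
  exact (Real.sqrt_pos.mpr (gaussI_pos_aux ha hb t)).ne'

lemma gaussI_scale {a b l : ℝ} (hl : 0 < l) : gaussI (l * a) (l * b) = gaussI a b / l := by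
  unfold gaussI
  rw [← intervalIntegral.integral_div]
  congr 1
  ext t
  have : (l * a) ^ 2 * Real.cos t ^ 2 + (l * b) ^ 2 * Real.sin t ^ 2
      = l ^ 2 * (a ^ 2 * Real.cos t ^ 2 + b ^ 2 * Real.sin t ^ 2) := by ring
  rw [this, Real.sqrt_mul (by positivity), Real.sqrt_sq hl.le, one_div, one_div, mul_inv,
    div_eq_mul_inv, mul_comm]

lemma kint_eq {k : ℝ} (hk1 : k ^ 2 ≤ 1) : Kint k = gaussI 1 (Real.sqrt (1 - k ^ 2)) := by
  unfold Kint gaussI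
  congr 1
  ext t
  rw [Real.sq_sqrt (by linarith)]
  congr 2
  have := Real.sin_sq_add_cos_sq t
  linear_combination -this

lemma kint_eq' {k : ℝ} (hk0 : 0 < k) (hk1 : k < 1) : Kint (Real.sqrt (1 - k ^ 2)) = gaussI 1 k := by
  have h : k ^ 2 < 1 := by nlinarith
  have h2 : Real.sqrt (1 - k ^ 2) ^ 2 = 1 - k ^ 2 := Real.sq_sqrt (by linarith)
  rw [kint_eq (by rw [h2]; nlinarith), h2]
  congr 1
  rw [sub_sub_cancel, Real.sqrt_sq hk0.le]

lemma gaussI_strictAnti {x y : ℝ} (hx : 0 < x) (hxy : x < y) : gaussI 1 y < gaussI 1 x := by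
  unfold gaussI
  have hp : (0 : ℝ) < Real.pi / 2 := by positivity
  have key : ∀ t, x ^ 2 * Real.sin t ^ 2 ≤ y ^ 2 * Real.sin t ^ 2 := fun t => by gcongr
  apply intervalIntegral.integral_lt_integral_of_continuousOn_of_le_of_exists_lt hp
    (gaussI_cont one_pos (hx.trans hxy)).continuousOn (gaussI_cont one_pos hx).continuousOn
  · intro t _
    apply one_div_le_one_div_of_le (Real.sqrt_pos.mpr (gaussI_pos_aux one_pos hx t))
    apply Real.sqrt_le_sqrt
    linarith [key t]
  · refine ⟨Real.pi / 2, ⟨hp.le, le_rfl⟩, ?_⟩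
    apply one_div_lt_one_div_of_lt (Real.sqrt_pos.mpr (gaussI_pos_aux one_pos hx _))
    apply Real.sqrt_lt_sqrt (gaussI_pos_aux one_pos hx _).le
    simp
    nlinarith

lemma gaussI_bounds {a b : ℝ} (hb : 0 < b) (hab : b ≤ a) :
    Real.pi / 2 / a ≤ gaussI a b ∧ gaussI a b ≤ Real.pi / 2 / b := by
  have ha : 0 < a := hb.trans_le hab
  have hp : (0 : ℝ) ≤ Real.pi / 2 := by positivity
  have h2 : b ^ 2 ≤ a ^ 2 := by gcongr
  unfold gaussI
  constructor
  · have : Real.pi / 2 / a = ∫ t in (0 : ℝ)..(Real.pi / 2), 1 / a := by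
      rw [intervalIntegral.integral_const]; simp [div_eq_mul_inv]
    rw [this]
    apply intervalIntegral.integral_mono_on hp (by simp)
      ((gaussI_cont ha hb).intervalIntegrable _ _)
    intro t _
    apply one_div_le_one_div_of_le (Real.sqrt_pos.mpr (gaussI_pos_aux ha hb t))
    rw [Real.sqrt_le_left ha.le]
    nlinarith [Real.sin_sq_add_cos_sq t, sq_nonneg (Real.sin t)]
  · have : Real.pi / 2 / b = ∫ t in (0 : ℝ)..(Real.pi / 2), 1 / b := by
      rw [intervalIntegral.integral_const]; simp [div_eq_mul_inv]
    rw [this]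
    apply intervalIntegral.integral_mono_on hp
      ((gaussI_cont ha hb).intervalIntegrable _ _) (by simp)
    intro t _
    apply one_div_le_one_div_of_le hb
    apply Real.le_sqrt_of_sq_le
    nlinarith [Real.sin_sq_add_cos_sq t, sq_nonneg (Real.cos t)]

/-- The Gauss transformation. -/
lemma gaussI_agm {a b : ℝ} (ha : 0 < a) (hb : 0 < b) :
    gaussI ((a + b) / 2) (Real.sqrt (a * b)) = gaussI a b := by
  set A := (a + b) / 2 with hA
  set B := Real.sqrt (a * b) with hB
  have hA0 : 0 < A := by positivity
  have hB0 : 0 < B := Real.sqrt_pos.mpr (by positivity)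
  have hB2 : B ^ 2 = a * b := Real.sq_sqrt (by positivity)
  let F : ℝ → ℝ := fun t => 1 / Real.sqrt (A ^ 2 * Real.cos t ^ 2 + B ^ 2 * Real.sin t ^ 2)
  have hF : Continuous F := gaussI_cont hA0 hB0
  let g : ℝ → ℝ := fun t => (a - b) * (Real.sin t * Real.cos t) /
    (a * Real.cos t ^ 2 + b * Real.sin t ^ 2)
  let φ : ℝ → ℝ := fun t => 2 * t - Real.arctan (g t)
  let φ' : ℝ → ℝ := fun t => (a + b) * (a * Real.cos t ^ 2 + b * Real.sin t ^ 2) /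
    (a ^ 2 * Real.cos t ^ 2 + b ^ 2 * Real.sin t ^ 2)
  have hg1 : ∀ t, 1 + g t ^ 2 = (a ^ 2 * Real.cos t ^ 2 + b ^ 2 * Real.sin t ^ 2) /
      (a * Real.cos t ^ 2 + b * Real.sin t ^ 2) ^ 2 := by
    intro t
    have h0 := (gaussI_pos_aux2 ha hb t).ne'
    simp only [g]
    field_simp
    have := Real.sin_sq_add_cos_sq t
    linear_combination (a ^ 2 * Real.cos t ^ 2 + b ^ 2 * Real.sin t ^ 2) * this
  have hφ : ∀ t, HasDerivAt φ (φ' t) t := by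
    intro t
    have h0 := (gaussI_pos_aux2 ha hb t).ne'
    have h1 := (gaussI_pos_aux ha hb t).ne'
    have hs := Real.hasDerivAt_sin t
    have hc := Real.hasDerivAt_cos t
    have hgd := ((hs.mul hc).const_mul (a - b)).div
      (((hc.pow 2).const_mul a).add ((hs.pow 2).const_mul b)) h0
    have := ((hasDerivAt_id t).const_mul 2).sub hgd.arctan
    refine this.congr_deriv ?_
    have e1 := hg1 t
    simp only [g] at e1
    simp only [Pi.mul_apply, Pi.add_apply, Pi.pow_apply, Pi.div_apply, φ', e1]
    have hsc := Real.sin_sq_add_cos_sq t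
    field_simp
    push_cast
    ring_nf at hsc ⊢
    set E := a * Real.cos t ^ 2 + b * Real.sin t ^ 2
    set Δ := a ^ 2 * Real.cos t ^ 2 + b ^ 2 * Real.sin t ^ 2
    linear_combination (-(2 * Δ - (a + b) * E)) * hsc
  have hcomp : ∀ t, F (φ t) * φ' t =
      2 * (1 / Real.sqrt (a ^ 2 * Real.cos t ^ 2 + b ^ 2 * Real.sin t ^ 2)) := by
    intro t
    set s := Real.sin t with hs
    set c := Real.cos t with hc
    have hsc : s ^ 2 + c ^ 2 = 1 := Real.sin_sq_add_cos_sq t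
    have h0 : 0 < a * c ^ 2 + b * s ^ 2 := gaussI_pos_aux2 ha hb t
    have h1 : 0 < a ^ 2 * c ^ 2 + b ^ 2 * s ^ 2 := gaussI_pos_aux ha hb t
    set D := Real.sqrt (a ^ 2 * c ^ 2 + b ^ 2 * s ^ 2) with hD
    have hD0 : 0 < D := Real.sqrt_pos.mpr h1
    have hD2 : D ^ 2 = a ^ 2 * c ^ 2 + b ^ 2 * s ^ 2 := Real.sq_sqrt h1.le
    have hsq : Real.sqrt (1 + g t ^ 2) = D / (a * c ^ 2 + b * s ^ 2) := by
      rw [hg1, Real.sqrt_div h1.le, Real.sqrt_sq h0.le]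
    have hca : Real.cos (Real.arctan (g t)) = (a * c ^ 2 + b * s ^ 2) / D := by
      rw [Real.cos_arctan, hsq, one_div_div]
    have hsa : Real.sin (Real.arctan (g t)) = (a - b) * (s * c) / D := by
      rw [Real.sin_arctan, hsq]
      simp only [g]
      rw [← hs, ← hc]
      field_simp
    have hcφ : Real.cos (φ t) = (a * c ^ 2 - b * s ^ 2) / D := by
      simp only [φ]
      rw [Real.cos_sub, hca, hsa, Real.cos_two_mul, Real.sin_two_mul, ← hs, ← hc]
      field_simp
      linear_combination (2*a*c^2) * hsc
    have hsφ : Real.sin (φ t) = (a + b) * (s * c) / D := by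
      simp only [φ]
      rw [Real.sin_sub, hca, hsa, Real.cos_two_mul, Real.sin_two_mul, ← hs, ← hc]
      field_simp
      linear_combination (2*b*s*c) * hsc
    have hin : A ^ 2 * Real.cos (φ t) ^ 2 + B ^ 2 * Real.sin (φ t) ^ 2 =
        ((a + b) * (a * c ^ 2 + b * s ^ 2) / (2 * D)) ^ 2 := by
      rw [hcφ, hsφ, hB2, hA]
      field_simp
      ring
    simp only [F, φ']
    rw [hin, Real.sqrt_sq (by positivity), ← hs, ← hc, ← hD2]
    field_simp
  have hφ'c : Continuous φ' := by
    refine Continuous.div (by fun_prop) (by fun_prop) (fun t => ?_)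
    exact (gaussI_pos_aux ha hb t).ne'
  have hsub : ∫ t in (0 : ℝ)..(Real.pi / 2), (F ∘ φ) t * φ' t =
      ∫ u in (φ 0)..(φ (Real.pi / 2)), F u :=
    intervalIntegral.integral_comp_mul_deriv (fun t _ => hφ t) hφ'c.continuousOn hF
  have e0 : φ 0 = 0 := by simp [φ, g]
  have e1 : φ (Real.pi / 2) = Real.pi := by simp [φ, g]; ring
  rw [e0, e1] at hsub
  have hsplit : ∫ u in (0 : ℝ)..Real.pi, F u = 2 * gaussI A B := by
    rw [← intervalIntegral.integral_add_adjacent_intervals (b := Real.pi / 2)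
      (hF.intervalIntegrable _ _) (hF.intervalIntegrable _ _)]
    have : ∫ u in (Real.pi / 2)..Real.pi, F u = ∫ u in (0 : ℝ)..(Real.pi / 2), F u := by
      have h := intervalIntegral.integral_comp_sub_left (a := 0) (b := Real.pi / 2) F Real.pi
      have h2 : ∀ x, F (Real.pi - x) = F x := by intro x; simp [F]
      simp only [h2] at h
      rw [h]
      congr 1 <;> ring
    rw [this, two_mul]
    rfl
  have hleft : ∫ t in (0 : ℝ)..(Real.pi / 2), (F ∘ φ) t * φ' t = 2 * gaussI a b := by
    simp only [Function.comp, hcomp]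
    rw [intervalIntegral.integral_const_mul]
    rfl
  linarith

lemma gaussI_log {x : ℝ} (hx : 0 < x) (hx1 : x < 1) :
    Real.log (1 / x) ≤ gaussI 1 x ∧
    Real.sqrt (1 - x ^ 2) * gaussI 1 x ≤ Real.log (2 / x) + Real.pi / 2 := by
  set y := Real.sqrt (1 - x ^ 2) with hy
  have hxx : 0 < 1 - x ^ 2 := by nlinarith
  have hy0 : 0 < y := Real.sqrt_pos.mpr hxx
  have hy2 : y ^ 2 = 1 - x ^ 2 := Real.sq_sqrt hxx.le
  have hy1 : y ≤ 1 := by nlinarith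
  have hp : (0 : ℝ) ≤ Real.pi / 2 := by positivity
  have hflip : gaussI 1 x = gaussI x 1 := by
    unfold gaussI
    have h := intervalIntegral.integral_comp_sub_left (a := 0) (b := Real.pi / 2)
      (fun t => 1 / Real.sqrt ((1 : ℝ) ^ 2 * Real.cos t ^ 2 + x ^ 2 * Real.sin t ^ 2)) (Real.pi / 2)
    simp only [Real.cos_pi_div_two_sub, Real.sin_pi_div_two_sub, sub_self, sub_zero] at h
    rw [← h]
    congr 1
    ext t
    rw [add_comm]
  have hc1 := gaussI_cont hx one_pos
  have hcc : Continuous (fun t => Real.cos t *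
      (1 / Real.sqrt (x ^ 2 * Real.cos t ^ 2 + (1 : ℝ) ^ 2 * Real.sin t ^ 2))) :=
    Real.continuous_cos.mul hc1
  have hh : ∫ t in (0 : ℝ)..(Real.pi / 2),
      Real.cos t * (1 / Real.sqrt (x ^ 2 * Real.cos t ^ 2 + (1 : ℝ) ^ 2 * Real.sin t ^ 2))
      = Real.arsinh (y / x) / y := by
    have hd : ∀ t ∈ Set.uIcc 0 (Real.pi / 2),
        HasDerivAt (fun t => Real.arsinh (y / x * Real.sin t) / y)
        (Real.cos t * (1 / Real.sqrt (x ^ 2 * Real.cos t ^ 2 + (1 : ℝ) ^ 2 * Real.sin t ^ 2))) t := by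
      intro t _
      have h := (((Real.hasDerivAt_sin t).const_mul (y / x)).arsinh).div_const y
      refine h.congr_deriv ?_
      have e : 1 + (y / x * Real.sin t) ^ 2 =
          (x ^ 2 * Real.cos t ^ 2 + (1 : ℝ) ^ 2 * Real.sin t ^ 2) / x ^ 2 := by
        field_simp
        rw [hy2]
        linear_combination (-x ^ 2) * Real.sin_sq_add_cos_sq t
      have := Real.sqrt_pos.mpr (gaussI_pos_aux hx one_pos t)
      rw [e, Real.sqrt_div (gaussI_pos_aux hx one_pos t).le, Real.sqrt_sq hx.le]
      simp only [smul_eq_mul]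
      field_simp
    rw [intervalIntegral.integral_eq_sub_of_hasDerivAt hd
      (hcc.intervalIntegrable _ _)]
    simp
  have has : Real.arsinh (y / x) = Real.log ((1 + y) / x) := by
    rw [Real.arsinh]
    have e : 1 + (y / x) ^ 2 = (1 / x) ^ 2 := by
      field_simp; rw [hy2]; ring
    rw [e, Real.sqrt_sq (by positivity)]
    congr 1
    field_simp
    ring
  have l1 : Real.log (1 / x) ≤ Real.arsinh (y / x) := by
    rw [has]
    apply Real.log_le_log (by positivity)
    gcongr
    linarith
  have l2 : Real.arsinh (y / x) ≤ Real.log (2 / x) := by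
    rw [has]
    apply Real.log_le_log (by positivity)
    gcongr
    linarith
  have l0 : 0 ≤ Real.log (1 / x) := Real.log_nonneg (by rw [le_div_iff₀ hx]; linarith)
  have hcos0 : ∀ t ∈ Set.Icc 0 (Real.pi / 2), 0 ≤ Real.cos t := fun t ht =>
    Real.cos_nonneg_of_mem_Icc ⟨by linarith [ht.1], ht.2⟩
  have b1 : Real.arsinh (y / x) / y ≤ gaussI x 1 := by
    rw [← hh]
    unfold gaussI
    apply intervalIntegral.integral_mono_on hp
      (hcc.intervalIntegrable _ _) (hc1.intervalIntegrable _ _)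
    intro t ht
    have : 0 ≤ 1 / Real.sqrt (x ^ 2 * Real.cos t ^ 2 + (1 : ℝ) ^ 2 * Real.sin t ^ 2) := by positivity
    nlinarith [Real.cos_le_one t]
  have b2 : gaussI x 1 ≤ Real.arsinh (y / x) / y + Real.pi / 2 := by
    have h1 : ∫ t in (0 : ℝ)..(Real.pi / 2), (1 : ℝ) = Real.pi / 2 := by simp
    have h2 := intervalIntegral.integral_add (μ := MeasureTheory.volume)
      (hcc.intervalIntegrable 0 (Real.pi / 2))
      ((continuous_const (y := (1 : ℝ))).intervalIntegrable 0 (Real.pi / 2))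
    rw [h1, hh] at h2
    rw [← h2]
    unfold gaussI
    apply intervalIntegral.integral_mono_on hp (hc1.intervalIntegrable _ _)
      ((hcc.add continuous_const).intervalIntegrable _ _)
    intro t ht
    have hs := Real.sqrt_pos.mpr (gaussI_pos_aux hx one_pos t)
    have hcs := hcos0 t ht
    have : 1 - Real.cos t ≤ Real.sqrt (x ^ 2 * Real.cos t ^ 2 + (1 : ℝ) ^ 2 * Real.sin t ^ 2) := by
      apply Real.le_sqrt_of_sq_le
      nlinarith [Real.sin_sq_add_cos_sq t, Real.cos_le_one t, sq_nonneg (x * Real.cos t)]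
    simp only [Pi.add_apply]
    rw [mul_one_div, div_add' _ _ _ hs.ne', div_le_div_iff_of_pos_right hs]
    linarith
  rw [hflip]
  constructor
  · refine le_trans l1 (le_trans ?_ b1)
    rw [le_div_iff₀ hy0]
    nlinarith
  · have : y * gaussI x 1 ≤ y * (Real.arsinh (y / x) / y + Real.pi / 2) := by gcongr
    have e : y * (Real.arsinh (y / x) / y + Real.pi / 2) = Real.arsinh (y / x) + y * (Real.pi / 2) := by
      field_simp
    nlinarith

lemma hs_congr {ι : Type*} {f g : ι → ℝ} {a b : ℝ} (h : HasSum f a) (hf : ∀ i, g i = f i)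
    (hb : b = a) : HasSum g b := by
  rw [hb, funext hf]; exact h

/-- Terms `sech((n+s)x)`. -/
noncomputable def sw (s x : ℝ) (n : ℤ) : ℝ := 1 / Real.cosh ((n + s) * x)

noncomputable def sa (x : ℝ) : ℝ := ∑' n : ℤ, sw 0 x n
noncomputable def sb (x : ℝ) : ℝ := ∑' n : ℤ, (-1 : ℝ) ^ n * sw 0 x n
noncomputable def sc (x : ℝ) : ℝ := ∑' n : ℤ, sw (1 / 2) x n

lemma sw_pos (s x : ℝ) (n : ℤ) : 0 < sw s x n := one_div_pos.mpr (Real.cosh_pos _)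

lemma sech_le (y : ℝ) : 1 / Real.cosh y ≤ 2 * Real.exp (-|y|) := by
  rw [div_le_iff₀ (Real.cosh_pos _), Real.exp_neg, ← Real.cosh_abs, Real.cosh_eq]
  have := Real.exp_pos |y|
  have := Real.exp_pos (-|y|)
  have e : 2 * (Real.exp |y|)⁻¹ * ((Real.exp |y| + Real.exp (-|y|)) / 2)
      = 1 + (Real.exp |y|)⁻¹ * Real.exp (-|y|) := by field_simp
  rw [e]
  have : 0 < (Real.exp |y|)⁻¹ * Real.exp (-|y|) := by positivity
  linarith

lemma summable_exp_nat {x : ℝ} (hx : 0 < x) : Summable (fun n : ℕ => Real.exp (-(n * x))) := by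
  have : ∀ n : ℕ, Real.exp (-(n * x)) = Real.exp (-x) ^ n := by
    intro n; rw [← Real.exp_nat_mul]; ring_nf
  simp only [this]
  exact summable_geometric_of_lt_one (Real.exp_pos _).le (by simpa using hx)

lemma summable_exp_abs {x : ℝ} (hx : 0 < x) : Summable (fun n : ℤ => Real.exp (-(|(n : ℝ)| * x))) := by
  apply Summable.of_nat_of_neg
  · simpa using summable_exp_nat hx
  · simpa using summable_exp_nat hx

lemma sw_summable (s : ℝ) {x : ℝ} (hx : 0 < x) : Summable (sw s x) := by
  refine Summable.of_nonneg_of_le (fun n => (sw_pos s x n).le) (fun n => ?_)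
    ((summable_exp_abs hx).mul_left (2 * Real.exp (|s| * x)))
  refine (sech_le _).trans ?_
  rw [mul_assoc, ← Real.exp_add]
  gcongr
  rw [abs_mul, abs_of_pos hx]
  have : |(n : ℝ)| ≤ |n + s| + |s| := by
    have := abs_sub (n + s : ℝ) s
    simpa using this
  nlinarith

lemma zpow_abs_one {e : ℝ} (he : |e| = 1) (n : ℤ) : |e ^ n| = 1 := by
  rw [abs_zpow, he, one_zpow]

lemma sw_summable_sign (s : ℝ) {x : ℝ} (hx : 0 < x) {e : ℝ} (he : |e| = 1) :
    Summable (fun n : ℤ => e ^ n * sw s x n) := by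
  apply Summable.of_abs
  simp only [abs_mul, zpow_abs_one he, one_mul]
  exact (sw_summable s hx).abs

/-- autocorrelation -/
noncomputable def sC (s x : ℝ) (d : ℤ) : ℝ := ∑' n : ℤ, sw s x (n + d) * sw s x n

lemma sq_sum (s : ℝ) {x : ℝ} (hx : 0 < x) {e : ℝ} (he : |e| = 1) :
    HasSum (fun d : ℤ => e ^ d * sC s x d) ((∑' n : ℤ, e ^ n * sw s x n) ^ 2) := by
  have hf := sw_summable_sign s hx he
  have hprod := summable_mul_of_summable_norm hf.norm hf.norm
  have hS := hf.hasSum.mul hf.hasSum hprod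
  let E : ℤ × ℤ ≃ ℤ × ℤ :=
    { toFun := fun p => (p.2 + p.1, p.2)
      invFun := fun p => (p.1 - p.2, p.2)
      left_inv := fun p => by simp
      right_inv := fun p => by simp }
  have hS2 := (E.hasSum_iff).mpr hS
  have e0 : e ≠ 0 := by rintro rfl; simp at he
  have e2 : e ^ 2 = 1 := by rw [← sq_abs, he]; norm_num
  have hterm : ∀ p : ℤ × ℤ, ((fun x_1 : ℤ × ℤ => e ^ x_1.1 * sw s x x_1.1 * (e ^ x_1.2 * sw s x x_1.2)) ∘ E) p
      = e ^ p.1 * (sw s x (p.2 + p.1) * sw s x p.2) := by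
    rintro ⟨d, n⟩
    simp only [Function.comp, E, Equiv.coe_fn_mk]
    have : e ^ (n + d) * e ^ n = e ^ d := by
      rw [← zpow_add₀ e0, show n + d + n = 2 * n + d by ring, zpow_add₀ e0, zpow_mul]
      have : e ^ (2 : ℤ) = 1 := by exact_mod_cast e2
      rw [this]; simp
    linear_combination (sw s x (n + d) * sw s x n) * this
  rw [funext hterm] at hS2
  have := hS2.prod_fiberwise (fun d => (hS2.summable.prod_factor d).hasSum)
  simp only [tsum_mul_left] at this
  rw [sq]
  exact this

lemma tendsto_tanh_top : Tendsto Real.tanh atTop (nhds 1) := by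
  have h : ∀ y, Real.tanh y = 1 - Real.exp (-y) * (1 / Real.cosh y) := by
    intro y
    rw [Real.tanh_eq_sinh_div_cosh]
    have := Real.cosh_pos y
    field_simp
    rw [Real.sinh_eq, Real.cosh_eq]; ring
  have h2 : Tendsto (fun y : ℝ => Real.exp (-y)) atTop (nhds 0) := Real.tendsto_exp_neg_atTop_nhds_zero
  have h3 : Tendsto (fun y : ℝ => Real.exp (-y) * (1 / Real.cosh y)) atTop (nhds 0) := by
    refine squeeze_zero (fun y => by have := Real.cosh_pos y; positivity) (fun y => ?_) h2
    have : 1 / Real.cosh y ≤ 1 := by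
      rw [div_le_one (Real.cosh_pos y)]; exact Real.one_le_cosh y
    nlinarith [Real.exp_pos (-y)]
  have h4 := h3.const_sub 1
  rw [sub_zero] at h4
  exact h4.congr (fun y => (h y).symm)

lemma tanh_sub_tanh (A B : ℝ) :
    Real.tanh A - Real.tanh B = Real.sinh (A - B) * (1 / Real.cosh A * (1 / Real.cosh B)) := by
  have := Real.cosh_pos A
  have := Real.cosh_pos B
  rw [Real.tanh_eq_sinh_div_cosh, Real.tanh_eq_sinh_div_cosh, Real.sinh_sub]
  field_simp

lemma tanh_tele_one (s : ℝ) {x : ℝ} (hx : 0 < x) :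
    HasSum (fun n : ℤ => Real.tanh ((n + s + 1) * x) - Real.tanh ((n + s) * x)) 2 := by
  have hnn : ∀ y, 0 ≤ Real.tanh ((y + 1) * x) - Real.tanh (y * x) := by
    intro y
    rw [tanh_sub_tanh]
    have := Real.cosh_pos ((y + 1) * x)
    have := Real.cosh_pos (y * x)
    have : 0 ≤ Real.sinh ((y + 1) * x - y * x) := Real.sinh_nonneg_iff.mpr (by nlinarith)
    positivity
  have hlim : ∀ s : ℝ, Tendsto (fun n : ℕ => Real.tanh ((n + s) * x)) atTop (nhds 1) := by
    intro s
    apply tendsto_tanh_top.comp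
    apply Tendsto.atTop_mul_const hx
    exact tendsto_atTop_add_const_right _ _ tendsto_natCast_atTop_atTop
  have h1 : HasSum (fun n : ℕ => Real.tanh (((n : ℤ) + s + 1) * x) - Real.tanh (((n : ℤ) + s) * x))
      (1 - Real.tanh (s * x)) := by
    rw [hasSum_iff_tendsto_nat_of_nonneg (fun n => hnn _)]
    have : ∀ N : ℕ, ∑ n ∈ Finset.range N,
        (Real.tanh (((n : ℤ) + s + 1) * x) - Real.tanh (((n : ℤ) + s) * x))
        = Real.tanh ((N + s) * x) - Real.tanh (s * x) := by
      intro N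
      have := Finset.sum_range_sub (fun n : ℕ => Real.tanh ((n + s) * x)) N
      simp only [Nat.cast_zero, zero_add] at this
      rw [← this]
      apply Finset.sum_congr rfl
      intro n _
      push_cast
      ring_nf
    simp only [this]
    exact (hlim s).sub_const _
  have h2 : HasSum (fun n : ℕ => Real.tanh ((((-(n + 1) : ℤ) : ℝ) + s + 1) * x)
      - Real.tanh ((((-(n + 1) : ℤ) : ℝ) + s) * x)) (1 + Real.tanh (s * x)) := by
    rw [hasSum_iff_tendsto_nat_of_nonneg (fun n => hnn _)]
    have : ∀ N : ℕ, ∑ n ∈ Finset.range N,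
        (Real.tanh ((((-(n + 1) : ℤ) : ℝ) + s + 1) * x)
      - Real.tanh ((((-(n + 1) : ℤ) : ℝ) + s) * x))
        = Real.tanh ((N + -s) * x) - Real.tanh (-s * x) := by
      intro N
      have := Finset.sum_range_sub (fun n : ℕ => Real.tanh ((n + -s) * x)) N
      simp only [Nat.cast_zero, zero_add] at this
      rw [← this]
      apply Finset.sum_congr rfl
      intro n _
      have e1 : (((-(n + 1) : ℤ) : ℝ) + s + 1) * x = -((n + -s) * x) := by push_cast; ring
      have e2 : (((-(n + 1) : ℤ) : ℝ) + s) * x = -(((n + 1 : ℕ) + -s) * x) := by push_cast; ring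
      rw [e1, e2, Real.tanh_neg, Real.tanh_neg]
      ring
    simp only [this]
    have := (hlim (-s)).sub_const (Real.tanh (-s * x))
    have e : 1 + Real.tanh (s * x) = 1 - Real.tanh (-s * x) := by
      rw [neg_mul, Real.tanh_neg, sub_neg_eq_add]
    rw [e]
    exact this
  have := HasSum.of_nat_of_neg_add_one
    (f := fun n : ℤ => Real.tanh ((n + s + 1) * x) - Real.tanh ((n + s) * x)) h1 h2
  exact hs_congr this (fun n => rfl) (by ring)

lemma tanh_tele {x : ℝ} (hx : 0 < x) (d : ℤ) : ∀ s : ℝ,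
    HasSum (fun n : ℤ => Real.tanh ((n + s + d) * x) - Real.tanh ((n + s) * x)) (2 * d) := by
  induction d using Int.induction_on with
  | zero => intro s; simp [hasSum_zero]
  | succ d ih =>
    intro s
    have := (tanh_tele_one (s + d) hx).add (ih s)
    refine hs_congr this (fun n => ?_) ?_
    · push_cast; ring_nf
    · push_cast; ring
  | pred d ih =>
    intro s
    have := (ih s).sub (tanh_tele_one (s + (-d - 1)) hx)
    refine hs_congr this (fun n => ?_) ?_
    · push_cast; ring_nf
    · push_cast; ring

lemma sC_eq (s : ℝ) {x : ℝ} (hx : 0 < x) (d : ℤ) (hd : d ≠ 0) :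
    sC s x d = 2 * d / Real.sinh (d * x) := by
  have hs : Real.sinh (d * x) ≠ 0 := by
    rw [Ne, Real.sinh_eq_zero]
    have : (d : ℝ) ≠ 0 := by exact_mod_cast hd
    positivity
  have h := (tanh_tele hx d s).div_const (Real.sinh (d * x))
  unfold sC
  rw [← h.tsum_eq]
  apply tsum_congr
  intro n
  rw [tanh_sub_tanh]
  unfold sw
  have e : (n + s + d) * x - (n + s) * x = d * x := by ring
  have e2 : (((n + d : ℤ) : ℝ) + s) * x = (n + s + d) * x := by push_cast; ring
  rw [e, e2]
  field_simp

lemma sech_sq_series {y : ℝ} (hy : 0 < y) :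
    HasSum (fun d : ℕ => 4 * ((-1) ^ d * (d + 1) * Real.exp (-(2 * y)) ^ (d + 1)))
      ((1 / Real.cosh y) ^ 2) := by
  have h0 := Real.exp_pos (-(2 * y))
  have h1 : Real.exp (-(2 * y)) < 1 := by simpa using hy
  have h := hasSum_coe_mul_geometric_of_norm_lt_one (𝕜 := ℝ) (r := -Real.exp (-(2 * y)))
    (by simpa using hy)
  rw [← hasSum_nat_add_iff' 1] at h
  have h' := h.mul_left (-4)
  refine hs_congr h' (fun d => ?_) ?_
  · push_cast; rw [neg_pow (Real.exp _)]; ring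
  · simp
    rw [Real.cosh_eq]
    have e : Real.exp (-(2 * y)) = Real.exp (-y) ^ 2 := by rw [← Real.exp_nat_mul]; ring_nf
    have e2 : Real.exp y = (Real.exp (-y))⁻¹ := by rw [Real.exp_neg, inv_inv]
    rw [e, e2]
    have := Real.exp_pos (-y)
    field_simp
    ring

lemma sinh_series {y : ℝ} (hy : 0 < y) :
    HasSum (fun n : ℕ => 2 * Real.exp (-y) ^ (2 * n + 1)) (1 / Real.sinh y) := by
  have h0 := Real.exp_pos (-y)
  have h1 : Real.exp (-y) < 1 := by simpa using hy
  have h2 : Real.exp (-y) ^ 2 < 1 := by nlinarith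
  have h := (hasSum_geometric_of_lt_one (by positivity) h2).mul_left (2 * Real.exp (-y))
  refine hs_congr h (fun n => ?_) ?_
  · rw [pow_add, pow_mul]; ring
  · rw [Real.sinh_eq]
    have e2 : Real.exp y = (Real.exp (-y))⁻¹ := by rw [Real.exp_neg, inv_inv]
    rw [e2]
    have h3 : 1 - Real.exp (-y) ^ 2 ≠ 0 := by linarith
    field_simp

lemma dbl_summable {x : ℝ} (hx : 0 < x) : Summable (fun p : ℕ × ℕ =>
    4 * ((-1) ^ p.2 * ((p.2 : ℝ) + 1) * Real.exp (-((2 * p.1 + 1) * (p.2 + 1) * x)))) := by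
  have h1 := summable_exp_nat hx
  have hr : ‖Real.exp (-x)‖ < 1 := by simpa using hx
  have h2 : Summable (fun d : ℕ => ((d : ℝ) + 1) * Real.exp (-(d * x))) := by
    have h3 := (hasSum_coe_mul_geometric_of_norm_lt_one (𝕜 := ℝ) hr).summable
    have := h3.add h1
    refine this.congr ?_
    intro d
    have : Real.exp (-(d * x)) = Real.exp (-x) ^ d := by rw [← Real.exp_nat_mul]; ring_nf
    rw [this]; ring
  have h4 := (summable_mul_of_summable_norm h1.norm h2.norm).mul_left 4
  refine Summable.of_norm_bounded h4 ?_
  rintro ⟨n, d⟩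
  simp only [norm_mul, norm_pow, norm_neg, norm_one, one_pow, one_mul, Real.norm_eq_abs, Real.abs_exp]
  rw [abs_of_pos (by positivity : (0 : ℝ) < 4), abs_of_pos (by positivity : (0 : ℝ) < (d : ℝ) + 1)]
  have : Real.exp (-((2 * n + 1) * (d + 1) * x)) ≤ Real.exp (-(n * x)) * Real.exp (-(d * x)) := by
    rw [← Real.exp_add]
    apply Real.exp_le_exp.mpr
    have hn : (0 : ℝ) ≤ n := by positivity
    have hd : (0 : ℝ) ≤ d := by positivity
    have : (0 : ℝ) ≤ (2 * n * d + n + 1) * x := by positivity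
    nlinarith
  have h0 : (0 : ℝ) ≤ (d : ℝ) + 1 := by positivity
  nlinarith [mul_le_mul_of_nonneg_left this h0]

lemma lin_id {x : ℝ} (hx : 0 < x) :
    HasSum (fun d : ℤ => (-1 : ℝ) ^ d * (2 * d / Real.sinh (d * x))) (- sC (1 / 2) x 0) := by
  have hD := dbl_summable hx
  set T := ∑' p : ℕ × ℕ, 4 * ((-1) ^ p.2 * ((p.2 : ℝ) + 1) * Real.exp (-((2 * p.1 + 1) * (p.2 + 1) * x))) with hT
  have hN : HasSum (fun n : ℕ => (1 / Real.cosh ((n + 1 / 2) * x)) ^ 2) T := by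
    refine hD.hasSum.prod_fiberwise (fun n => ?_)
    have h := sech_sq_series (y := (n + 1 / 2) * x) (by positivity)
    refine hs_congr h (fun d => ?_) rfl
    rw [← Real.exp_nat_mul]
    push_cast
    ring_nf
  have hM : HasSum (fun d : ℕ => (-1) ^ d * (2 * ((d : ℝ) + 1) / Real.sinh ((d + 1) * x))) T := by
    have hsw := ((Equiv.prodComm ℕ ℕ).hasSum_iff).mpr hD.hasSum
    refine hsw.prod_fiberwise (fun d => ?_)
    have h := (sinh_series (y := (d + 1) * x) (by positivity)).mul_left (2 * (-1) ^ d * ((d : ℝ) + 1))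
    refine hs_congr h (fun n => ?_) ?_
    · simp only [Function.comp, Equiv.prodComm_apply, Prod.swap]
      rw [← Real.exp_nat_mul]
      push_cast
      ring_nf
    · ring
  have hC : sC (1 / 2) x 0 = T + T := by
    refine HasSum.tsum_eq ?_
    apply HasSum.of_nat_of_neg_add_one
    · refine hs_congr hN (fun n => ?_) rfl
      simp [sw, sq]
    · refine hs_congr hN (fun n => ?_) rfl
      have : (((-(n + 1) : ℤ) : ℝ) + 1 / 2) * x = -((n + 1 / 2) * x) := by push_cast; ring
      simp only [sw, add_zero, sq, this, Real.cosh_neg]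
  have hm : HasSum (fun d : ℕ => (-1 : ℝ) ^ ((d : ℤ) + 1) * (2 * (((d : ℤ) + 1 : ℤ) : ℝ) /
      Real.sinh ((((d : ℤ) + 1 : ℤ) : ℝ) * x))) (-T) := by
    refine hs_congr hM.neg (fun d => ?_) rfl
    rw [zpow_add₀ (by norm_num)]
    push_cast
    simp
  have := HasSum.of_add_one_of_neg_add_one
    (f := fun d : ℤ => (-1 : ℝ) ^ d * (2 * d / Real.sinh (d * x))) (m := -T) (m' := -T) hm ?_
  · refine hs_congr this (fun d => rfl) ?_
    rw [hC]; simp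
  · refine hs_congr hm (fun d => ?_) rfl
    rw [zpow_neg, ← inv_zpow]
    push_cast
    rw [neg_mul, Real.sinh_neg, div_neg, ← neg_div]
    norm_num
    left
    ring

/-- The quadratic relation. -/
lemma quad_rel {x : ℝ} (hx : 0 < x) : sa x ^ 2 = sb x ^ 2 + sc x ^ 2 := by
  have ha : HasSum (fun d : ℤ => sC 0 x d) (sa x ^ 2) := by
    simpa [sa] using sq_sum 0 hx (e := 1) (by simp)
  have hb : HasSum (fun d : ℤ => (-1 : ℝ) ^ d * sC 0 x d) (sb x ^ 2) := by
    simpa [sb] using sq_sum 0 hx (e := -1) (by simp)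
  have hc : HasSum (fun d : ℤ => sC (1 / 2) x d) (sc x ^ 2) := by
    simpa [sc] using sq_sum (1 / 2) hx (e := 1) (by simp)
  have h0 : HasSum (fun d : ℤ => if d = 0 then sC (1 / 2) x 0 else 0) (sC (1 / 2) x 0) :=
    hasSum_ite_eq 0 _
  have h1 := (ha.sub hb).sub hc
  have h2 := ((lin_id hx).add h0).neg
  have : (fun d : ℤ => sC 0 x d - (-1 : ℝ) ^ d * sC 0 x d - sC (1 / 2) x d) =
      fun d : ℤ => -((-1 : ℝ) ^ d * (2 * d / Real.sinh (d * x)) + if d = 0 then sC (1 / 2) x 0 else 0) := by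
    ext d
    by_cases hd : d = 0
    · subst hd; simp
    · rw [sC_eq 0 hx d hd, sC_eq (1 / 2) hx d hd, if_neg hd]; ring
  rw [this] at h1
  have := h1.unique h2
  linarith

lemma int_even_odd {f : ℤ → ℝ} (hf : Summable f) :
    ∑' n, f n = ∑' n, f (2 * n) + ∑' n, f (2 * n + 1) := by
  have i1 : Function.Injective (fun n : ℤ => 2 * n) := fun a b h => by simpa using h
  have i2 : Function.Injective (fun n : ℤ => 2 * n + 1) := fun a b h => by simpa using h
  have hc : IsCompl (Set.range (fun n : ℤ => 2 * n)) (Set.range (fun n : ℤ => 2 * n + 1)) := by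
    rw [← compl_eq_iff_isCompl, Set.ext_iff]
    intro n
    simp only [Set.mem_compl_iff, Set.mem_range, not_exists]
    constructor
    · intro h
      rcases Int.even_or_odd' n with ⟨m, h1 | h1⟩
      · exact absurd h1.symm (h m)
      · exact ⟨m, h1.symm⟩
    · rintro ⟨m, rfl⟩ y
      lia
  have e1 := (hf.comp_injective i1).hasSum
  have e2 := (hf.comp_injective i2).hasSum
  exact ((i1.hasSum_range_iff.mpr e1).add_isCompl hc (i2.hasSum_range_iff.mpr e2)).tsum_eq

lemma sa_add_sb {x : ℝ} (hx : 0 < x) :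
    sa x + sb x = 2 * sa (2 * x) ∧ sa x - sb x = 2 * sc (2 * x) := by
  have h1 := sw_summable 0 hx
  have h2 := sw_summable_sign 0 hx (e := -1) (by simp)
  have e1 : ∀ n : ℤ, sw 0 x (2 * n) = sw 0 (2 * x) n := by
    intro n; unfold sw; push_cast; ring_nf
  have e2 : ∀ n : ℤ, sw 0 x (2 * n + 1) = sw (1 / 2) (2 * x) n := by
    intro n; unfold sw; push_cast; ring_nf
  have e3 : ∀ n : ℤ, (-1 : ℝ) ^ (2 * n) = 1 := by
    intro n; rw [zpow_mul]; norm_num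
  have e4 : ∀ n : ℤ, (-1 : ℝ) ^ (2 * n + 1) = -1 := by
    intro n; rw [zpow_add₀ (by norm_num), e3]; norm_num
  have ha : sa x = sa (2 * x) + sc (2 * x) := by
    unfold sa sc
    rw [int_even_odd h1]
    simp only [e1, e2]
  have hb : sb x = sa (2 * x) - sc (2 * x) := by
    unfold sa sb sc
    rw [int_even_odd h2]
    simp only [e1, e2, e3, e4, one_mul, neg_mul, tsum_neg, sub_eq_add_neg]
  constructor <;> linarith

lemma sw_sum_tendsto {e : ℝ} (he : |e| = 1) :
    Tendsto (fun x : ℝ => ∑' n : ℤ, e ^ n * sw 0 x n) atTop (nhds 1) := by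
  have hlim : Tendsto (fun x : ℝ => ∑' n : ℤ, e ^ n * sw 0 x n) atTop
      (nhds (∑' n : ℤ, if n = 0 then (1 : ℝ) else 0)) := by
    refine tendsto_tsum_of_dominated_convergence
      (bound := fun n : ℤ => 2 * Real.exp (-(|(n : ℝ)| * 1)))
      ((summable_exp_abs one_pos).mul_left 2) ?_ ?_
    · intro n
      by_cases hn : n = 0
      · subst hn; simp [sw]
      · rw [if_neg hn]
        have hn' : 0 < |(n : ℝ)| := abs_pos.mpr (by exact_mod_cast hn)
        have h2 : Tendsto (fun x : ℝ => 2 * Real.exp (-(|(n : ℝ)| * x))) atTop (nhds 0) := by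
          have := (Real.tendsto_exp_neg_atTop_nhds_zero.comp
            (tendsto_id.const_mul_atTop hn')).const_mul 2
          simpa using this
        apply squeeze_zero_norm' _ h2
        filter_upwards [eventually_ge_atTop 0] with x hx
        rw [norm_mul, Real.norm_eq_abs, zpow_abs_one he, one_mul, Real.norm_eq_abs,
          abs_of_pos (sw_pos _ _ _)]
        refine (sech_le _).trans ?_
        rw [add_zero, abs_mul, abs_of_nonneg hx]
    · filter_upwards [eventually_ge_atTop 1] with x hx n
      rw [norm_mul, Real.norm_eq_abs, zpow_abs_one he, one_mul, Real.norm_eq_abs,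
          abs_of_pos (sw_pos _ _ _)]
      refine (sech_le _).trans ?_
      rw [add_zero, abs_mul, abs_of_nonneg (by linarith : (0 : ℝ) ≤ x)]
      gcongr
  rwa [tsum_ite_eq] at hlim

lemma sa_tendsto : Tendsto sa atTop (nhds 1) := by
  have h := sw_sum_tendsto (e := 1) (by simp)
  simp only [one_zpow, one_mul] at h
  exact h

lemma sb_tendsto : Tendsto sb atTop (nhds 1) := sw_sum_tendsto (e := -1) (by simp)

lemma sa_pos {x : ℝ} (hx : 0 < x) : 0 < sa x :=
  (sw_summable 0 hx).tsum_pos (fun n => (sw_pos _ _ n).le) 0 (sw_pos _ _ 0)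

lemma sc_pos {x : ℝ} (hx : 0 < x) : 0 < sc x :=
  (sw_summable _ hx).tsum_pos (fun n => (sw_pos _ _ n).le) 0 (sw_pos _ _ 0)

lemma sb_double {x : ℝ} (hx : 0 < x) : sb (2 * x) ^ 2 = sa x * sb x := by
  have h := quad_rel (x := 2 * x) (by positivity)
  obtain ⟨h1, h2⟩ := sa_add_sb hx
  have e1 : sa (2 * x) = (sa x + sb x) / 2 := by linarith
  have e2 : sc (2 * x) = (sa x - sb x) / 2 := by linarith
  rw [e1, e2] at h
  linarith

lemma sb_nonneg {x : ℝ} (hx : 0 < x) : 0 ≤ sb x := by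
  have h := sb_double hx
  have := sa_pos hx
  by_contra hc
  push Not at hc
  nlinarith [sq_nonneg (sb (2 * x)), mul_neg_of_pos_of_neg this hc]

lemma two_pow_tendsto {x : ℝ} (hx : 0 < x) :
    Tendsto (fun n : ℕ => (2 : ℝ) ^ n * x) atTop atTop :=
  (tendsto_pow_atTop_atTop_of_one_lt (by norm_num)).atTop_mul_const hx

lemma sb_pos {x : ℝ} (hx : 0 < x) : 0 < sb x := by
  rcases (sb_nonneg hx).eq_or_lt with h | h
  · exfalso
    have h0 : ∀ n : ℕ, sb (2 ^ n * x) = 0 := by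
      intro n
      induction n with
      | zero => simpa using h.symm
      | succ n ih =>
        have := sb_double (x := 2 ^ n * x) (by positivity)
        rw [ih, mul_zero] at this
        rw [pow_succ', mul_assoc]
        exact pow_eq_zero_iff (two_ne_zero) |>.mp this
    have h1 := sb_tendsto.comp (two_pow_tendsto hx)
    have h2 : (sb ∘ fun n : ℕ => 2 ^ n * x) = fun _ => 0 := funext h0
    rw [h2] at h1
    exact zero_ne_one (tendsto_nhds_unique tendsto_const_nhds h1)
  · exact h

lemma sb_le_sa {x : ℝ} (hx : 0 < x) : sb x ≤ sa x := by
  have := (sa_add_sb hx).2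
  have := sc_pos (x := 2 * x) (by positivity)
  linarith

lemma gauss_ab_double {x : ℝ} (hx : 0 < x) :
    gaussI (sa (2 * x)) (sb (2 * x)) = gaussI (sa x) (sb x) := by
  rw [← gaussI_agm (sa_pos hx) (sb_pos hx)]
  congr 1
  · linarith [(sa_add_sb hx).1]
  · rw [← sb_double hx, Real.sqrt_sq (sb_nonneg (by positivity))]

lemma gauss_ac_double {x : ℝ} (hx : 0 < x) :
    gaussI (sa (2 * x)) (sc (2 * x)) = 2 * gaussI (sa x) (sc x) := by
  have hx2 : 0 < 2 * x := by positivity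
  obtain ⟨h1, h2⟩ := sa_add_sb hx
  rw [← gaussI_agm (sa_pos hx2) (sc_pos hx2)]
  have e1 : (sa (2 * x) + sc (2 * x)) / 2 = 1 / 2 * sa x := by linarith
  have e2 : Real.sqrt (sa (2 * x) * sc (2 * x)) = 1 / 2 * sc x := by
    rw [Real.sqrt_eq_iff_mul_self_eq (mul_nonneg (sa_pos hx2).le (sc_pos hx2).le)
      (by have := sc_pos hx; positivity)]
    have := quad_rel hx
    have eA : sa (2 * x) = (sa x + sb x) / 2 := by linarith
    have eC : sc (2 * x) = (sa x - sb x) / 2 := by linarith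
    rw [eA, eC]
    nlinarith
  rw [e1, e2, gaussI_scale (by norm_num)]
  ring

lemma gauss_ab {x : ℝ} (hx : 0 < x) : gaussI (sa x) (sb x) = Real.pi / 2 := by
  have h0 : ∀ n : ℕ, gaussI (sa (2 ^ n * x)) (sb (2 ^ n * x)) = gaussI (sa x) (sb x) := by
    intro n
    induction n with
    | zero => simp
    | succ n ih =>
      rw [← ih, pow_succ', mul_assoc, gauss_ab_double (by positivity)]
  have ha := sa_tendsto.comp (two_pow_tendsto hx)
  have hb := sb_tendsto.comp (two_pow_tendsto hx)
  have hb1 := (tendsto_const_nhds (x := Real.pi / 2)).div hb one_ne_zero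
  have ha1 := (tendsto_const_nhds (x := Real.pi / 2)).div ha one_ne_zero
  rw [div_one] at ha1 hb1
  apply le_antisymm
  · refine ge_of_tendsto' hb1 (fun n => ?_)
    rw [← h0 n]
    have hx' : 0 < 2 ^ n * x := by positivity
    exact (gaussI_bounds (sb_pos hx') (sb_le_sa hx')).2
  · refine le_of_tendsto' ha1 (fun n => ?_)
    rw [← h0 n]
    have hx' : 0 < 2 ^ n * x := by positivity
    exact (gaussI_bounds (sb_pos hx') (sb_le_sa hx')).1

lemma sc_lower {x : ℝ} (hx : 0 < x) : Real.exp (-(x / 2)) ≤ sc x := by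
  have h1 : sw (1 / 2) x 0 ≤ sc x :=
    (sw_summable (1 / 2) hx).le_tsum 0 (fun n _ => (sw_pos _ _ n).le)
  refine le_trans ?_ h1
  unfold sw
  rw [Real.exp_neg, ← one_div]
  apply one_div_le_one_div_of_le (Real.cosh_pos _)
  rw [Real.cosh_eq]
  have : Real.exp (-(x / 2)) ≤ Real.exp (x / 2) := Real.exp_le_exp.mpr (by linarith)
  have e : (((0 : ℤ) : ℝ) + 1 / 2) * x = x / 2 := by push_cast; ring
  rw [e]
  linarith

lemma sc_upper {x : ℝ} (hx : 0 < x) : ∃ C : ℝ, 0 < C ∧ ∀ y, x ≤ y → sc y ≤ C * Real.exp (-(y / 2)) := by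
  have hS : Summable (fun n : ℤ => Real.exp (x * (3 / 2)) * (2 * Real.exp (-(|(n : ℝ)| * x)))) :=
    ((summable_exp_abs hx).mul_left 2).mul_left _
  refine ⟨∑' n : ℤ, Real.exp (x * (3 / 2)) * (2 * Real.exp (-(|(n : ℝ)| * x))), ?_, ?_⟩
  · exact hS.tsum_pos (fun n => by positivity) 0 (by positivity)
  · intro y hy
    rw [← tsum_mul_right]
    refine (sw_summable _ (hx.trans_le hy)).tsum_le_tsum (fun n => ?_) (hS.mul_right _)
    refine (sech_le _).trans ?_
    rw [mul_left_comm, mul_assoc, ← Real.exp_add, ← Real.exp_add]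
    gcongr
    rw [abs_mul, abs_of_pos (hx.trans_le hy)]
    have h1 : |(n : ℝ)| ≤ |(n : ℝ) + 1 / 2| + 1 / 2 := by
      have := abs_sub ((n : ℝ) + 1 / 2) (1 / 2)
      rw [abs_of_pos (by norm_num : (0 : ℝ) < 1 / 2)] at this
      simpa using this
    have h2 : 1 / 2 ≤ |(n : ℝ) + 1 / 2| := by
      rcases le_or_gt 0 n with h | h
      · have : (0 : ℝ) ≤ n := by exact_mod_cast h
        rw [abs_of_nonneg (by linarith)]; linarith
      · have : (n : ℝ) ≤ -1 := by exact_mod_cast (by lia : n ≤ -1)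
        rw [abs_of_neg (by linarith)]; linarith
    nlinarith [mul_nonneg (sub_nonneg.mpr h2) (sub_nonneg.mpr hy)]

lemma gauss_ac {x : ℝ} (hx : 0 < x) : gaussI (sa x) (sc x) = x / 2 := by
  set J := gaussI (sa x) (sc x) with hJ
  have h0 : ∀ n : ℕ, gaussI (sa (2 ^ n * x)) (sc (2 ^ n * x)) = 2 ^ n * J := by
    intro n
    induction n with
    | zero => simp [hJ]
    | succ n ih =>
      rw [pow_succ', mul_assoc, gauss_ac_double (by positivity), ih]; ring
  have ha : Tendsto (fun n : ℕ => sa (2 ^ n * x)) atTop (nhds 1) := sa_tendsto.comp (two_pow_tendsto hx)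
  have hb : Tendsto (fun n : ℕ => sb (2 ^ n * x)) atTop (nhds 1) := sb_tendsto.comp (two_pow_tendsto hx)
  obtain ⟨C, hC0, hC⟩ := sc_upper hx
  have hp0 : Tendsto (fun n : ℕ => ((2 : ℝ) ^ n)⁻¹) atTop (nhds 0) :=
    tendsto_inv_atTop_zero.comp (tendsto_pow_atTop_atTop_of_one_lt (by norm_num))
  have hla : Tendsto (fun n : ℕ => Real.log (sa (2 ^ n * x))) atTop (nhds 0) := by
    simpa using ha.log one_ne_zero
  have hlev : ∀ n : ℕ,
      (Real.log (sa (2 ^ n * x)) - Real.log C) * ((2 : ℝ) ^ n)⁻¹ + x / 2 ≤ J * sa (2 ^ n * x) ∧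
      sb (2 ^ n * x) * J ≤ (Real.log 2 + Real.log (sa (2 ^ n * x)) + Real.pi / 2) * ((2 : ℝ) ^ n)⁻¹
        + x / 2 := by
    intro n
    have hn := h0 n
    have h1n : (1 : ℝ) ≤ 2 ^ n := one_le_pow₀ (by norm_num)
    set y := 2 ^ n * x with hy
    have hy0 : 0 < y := by positivity
    have hxy : x ≤ y := by nlinarith
    have A0 := sa_pos hy0
    have B0 := sb_pos hy0
    have C0 := sc_pos hy0
    have hq := quad_rel hy0
    have hca : sc y < sa y := by nlinarith
    have hκ0 : 0 < sc y / sa y := by positivity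
    have hκ1 : sc y / sa y < 1 := by rw [div_lt_one A0]; exact hca
    obtain ⟨l1, l2⟩ := gaussI_log hκ0 hκ1
    have hg : gaussI 1 (sc y / sa y) = 2 ^ n * J * sa y := by
      have := gaussI_scale (a := 1) (b := sc y / sa y) A0
      rw [mul_one, mul_div_cancel₀ _ A0.ne', hn] at this
      field_simp at this
      linarith
    have hs : Real.sqrt (1 - (sc y / sa y) ^ 2) = sb y / sa y := by
      rw [Real.sqrt_eq_iff_mul_self_eq (by rw [sub_nonneg]; nlinarith) (by positivity)]
      field_simp
      linarith
    rw [hg] at l1 l2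
    rw [hs] at l2
    have hlog1 : Real.log (1 / (sc y / sa y)) = Real.log (sa y) - Real.log (sc y) := by
      rw [one_div_div, Real.log_div A0.ne' C0.ne']
    have hlog2 : Real.log (2 / (sc y / sa y)) = Real.log 2 + (Real.log (sa y) - Real.log (sc y)) := by
      rw [Real.log_div two_ne_zero hκ0.ne', Real.log_div C0.ne' A0.ne']; ring
    have c1 : -(y / 2) ≤ Real.log (sc y) := by
      rw [Real.le_log_iff_exp_le C0]; exact sc_lower hy0
    have c2 : Real.log (sc y) ≤ Real.log C + -(y / 2) := by
      have := Real.log_le_log C0 (hC y hxy)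
      rwa [Real.log_mul hC0.ne' (Real.exp_pos _).ne', Real.log_exp] at this
    have hpn : (0 : ℝ) < 2 ^ n := by positivity
    constructor
    · rw [← sub_nonneg]
      have : 0 ≤ (2 ^ n * J * sa y - (Real.log (sa y) - Real.log C + y / 2)) * ((2 : ℝ) ^ n)⁻¹ := by
        apply mul_nonneg _ (by positivity)
        linarith
      convert! this using 1
      rw [hy]
      field_simp
    · rw [← sub_nonneg]
      have : 0 ≤ (Real.log 2 + (Real.log (sa y) + y / 2) + Real.pi / 2
          - sb y * (2 ^ n * J)) * ((2 : ℝ) ^ n)⁻¹ := by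
        have e : sb y / sa y * (2 ^ n * J * sa y) = sb y * (2 ^ n * J) := by field_simp
        rw [e] at l2
        apply mul_nonneg _ (by positivity)
        linarith
      convert! this using 1
      rw [hy]
      field_simp
      ring
  apply le_antisymm
  · have t1 := hb.mul_const J
    have t2 := (((hla.const_add (Real.log 2)).add_const (Real.pi / 2)).mul hp0).add_const (x / 2)
    have := le_of_tendsto_of_tendsto' t1 t2 (fun n => (hlev n).2)
    simpa using this
  · have t1 := ha.const_mul J
    have t2 := ((hla.sub_const (Real.log C)).mul hp0).add_const (x / 2)
    have := le_of_tendsto_of_tendsto' t2 t1 (fun n => (hlev n).1)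
    simpa using this

lemma kint_eq_sa {t k : ℝ} (ht : 0 < t) (hk0 : 0 < k) (hk1 : k < 1)
    (hK : Kint (Real.sqrt (1 - k ^ 2)) = t * Kint k) :
    Kint k = Real.pi / 2 * sa (Real.pi * t) := by
  set x := Real.pi * t with hx
  have hx0 : 0 < x := by positivity
  have A0 := sa_pos hx0
  have B0 := sb_pos hx0
  have C0 := sc_pos hx0
  have hq := quad_rel hx0
  have hk2 : k ^ 2 < 1 := by nlinarith
  rw [kint_eq' hk0 hk1, kint_eq hk2.le] at hK
  rw [kint_eq hk2.le]
  set k' := Real.sqrt (1 - k ^ 2) with hk'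
  have hk'0 : 0 < k' := Real.sqrt_pos.mpr (by linarith)
  have hk'2 : k' ^ 2 = 1 - k ^ 2 := Real.sq_sqrt (by linarith)
  have g1 : gaussI 1 (sc x / sa x) = x / 2 * sa x := by
    have := gaussI_scale (a := 1) (b := sc x / sa x) A0
    rw [mul_one, mul_div_cancel₀ _ A0.ne', gauss_ac hx0, eq_div_iff A0.ne'] at this
    exact this.symm
  have g2 : gaussI 1 (sb x / sa x) = Real.pi / 2 * sa x := by
    have := gaussI_scale (a := 1) (b := sb x / sa x) A0
    rw [mul_one, mul_div_cancel₀ _ A0.ne', gauss_ab hx0, eq_div_iff A0.ne'] at this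
    exact this.symm
  have hrel : gaussI 1 (sc x / sa x) = t * gaussI 1 (sb x / sa x) := by
    rw [g1, g2, hx]; ring
  set κ := sc x / sa x with hκ
  set κ' := sb x / sa x with hκ'
  have hκ0 : 0 < κ := by positivity
  have hκ'0 : 0 < κ' := by positivity
  have hκ2 : κ' ^ 2 = 1 - κ ^ 2 := by
    rw [hκ, hκ']
    field_simp
    linarith
  have hkk : k' = κ' := by
    rcases lt_trichotomy k κ with h | h | h
    · have h2 : κ' < k' := by nlinarith
      have i1 := gaussI_strictAnti hk0 h
      have i2 := gaussI_strictAnti hκ'0 h2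
      nlinarith
    · have : k' ^ 2 = κ' ^ 2 := by rw [hk'2, hκ2, h]
      exact (pow_left_inj₀ hk'0.le hκ'0.le two_ne_zero).mp this
    · have h2 : k' < κ' := by nlinarith
      have i1 := gaussI_strictAnti hκ0 h
      have i2 := gaussI_strictAnti hk'0 h2
      nlinarith
  rw [hkk, g2]

lemma sa_eq_series {x q : ℝ} (hx : 0 < x) (hq : q = Real.exp (-x)) :
    (sa x + 1) / 4 = ∑' n : ℕ, q ^ n / (1 + q ^ (2 * n)) := by
  have hterm : ∀ n : ℕ, 1 / Real.cosh (n * x) = 2 * (q ^ n / (1 + q ^ (2 * n))) := by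
    intro n
    have e : Real.exp (-(n * x)) = q ^ n := by rw [hq, ← Real.exp_nat_mul]; ring_nf
    have e2 : Real.exp (n * x) = (q ^ n)⁻¹ := by rw [← e, Real.exp_neg, inv_inv]
    have hq0 : 0 < q ^ n := by rw [← e]; exact Real.exp_pos _
    rw [Real.cosh_eq, e, e2, pow_mul', ]
    field_simp
  have hs := (sw_summable 0 hx)
  have h1 : Summable (fun n : ℕ => sw 0 x n) := hs.comp_injective Nat.cast_injective
  have e1 : ∀ n : ℕ, sw 0 x n = 2 * (q ^ n / (1 + q ^ (2 * n))) := by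
    intro n; rw [← hterm]; simp [sw]
  have e2 : ∀ n : ℕ, sw 0 x (-(n : ℤ)) = 2 * (q ^ n / (1 + q ^ (2 * n))) := by
    intro n; rw [← hterm]; simp [sw]
  simp only [e1] at h1
  have h2 := h1.hasSum
  have h3 := HasSum.of_nat_of_neg (f := sw 0 x) (hs_congr h2 e1 rfl) (hs_congr h2 e2 rfl)
  have h4 : sa x = _ := h3.tsum_eq
  rw [h4, tsum_mul_left]
  simp [sw]
  ring

/-- Partial numerators with an extra parameter `y`. -/
noncomputable def pcn (q y : ℝ) (n : ℕ) : ℝ :=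
  if n = 1 then 1 else y * (q ^ (n - 2) * (1 - q ^ (n - 1)) ^ 2)

/-- Partial denominators. -/
noncomputable def cfb (q : ℝ) (n : ℕ) : ℝ := 1 - q ^ (2 * n - 1)

/-- Coefficients of the basic hypergeometric series. -/
noncomputable def gco (q : ℝ) (m k : ℕ) : ℝ :=
  ∏ j ∈ Finset.range k, ((1 - q ^ (m + 2 * j)) * (1 - q ^ (m + 1 + 2 * j)) /
    ((1 - q ^ (2 * m + 1 + 2 * j)) * (1 - q ^ (2 + 2 * j))))

noncomputable def gfun (q y : ℝ) (m : ℕ) : ℝ := ∑' k : ℕ, gco q m k * (-y) ^ k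

lemma one_sub_pow_pos {q : ℝ} (h0 : 0 < q) (h1 : q < 1) (n : ℕ) : 0 < 1 - q ^ (n + 1) := by
  have := pow_lt_one₀ h0.le h1 (Nat.succ_ne_zero n)
  simpa using this

lemma one_sub_pow_pos' {q : ℝ} (h0 : 0 < q) (h1 : q < 1) {n : ℕ} (hn : 0 < n) : 0 < 1 - q ^ n := by
  have := pow_lt_one₀ h0.le h1 hn.ne'
  linarith

lemma gco_succ (q : ℝ) (m k : ℕ) : gco q m (k + 1) = gco q m k *
    ((1 - q ^ (m + 2 * k)) * (1 - q ^ (m + 1 + 2 * k)) /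
    ((1 - q ^ (2 * m + 1 + 2 * k)) * (1 - q ^ (2 + 2 * k)))) := by
  unfold gco; rw [Finset.prod_range_succ]

lemma gco_zero (q : ℝ) (m : ℕ) : gco q m 0 = 1 := by simp [gco]

lemma gco_r1 {q : ℝ} (h0 : 0 < q) (h1 : q < 1) (m k : ℕ) :
    gco q (m + 1) (k + 1) * ((1 - q ^ (2 * m + 3)) * (1 - q ^ (2 * k + 2))) =
      (1 - q ^ (m + 1)) * (1 - q ^ (m + 2 + 2 * k)) * gco q (m + 2) k := by
  induction k with
  | zero =>
    rw [gco_succ, gco_zero, gco_zero]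
    have a1 := (one_sub_pow_pos h0 h1 (2 * m + 2)).ne'
    have a2 := (one_sub_pow_pos h0 h1 1).ne'
    have e1 : 2 * (m + 1) + 1 + 2 * 0 = 2 * m + 2 + 1 := by ring
    rw [e1]
    simp only [mul_zero, add_zero, zero_add] at *
    norm_num at a2 ⊢
    field_simp
  | succ k ih =>
    rw [gco_succ, gco_succ q (m + 2) k]
    have a1 := (one_sub_pow_pos' h0 h1 (n := 2 * (m + 1) + 1 + 2 * (k + 1)) (by lia)).ne'
    have a2 := (one_sub_pow_pos' h0 h1 (n := 2 + 2 * (k + 1)) (by lia)).ne'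
    have a4 := (one_sub_pow_pos' h0 h1 (n := 2 + 2 * k) (by lia)).ne'
    have e1 : 2 * (m + 2) + 1 + 2 * k = 2 * (m + 1) + 1 + 2 * (k + 1) := by ring
    have e2 : 2 * (k + 1) + 2 = 2 + 2 * (k + 1) := by ring
    have e3 : m + 1 + 2 * (k + 1) = m + 2 + 1 + 2 * k := by ring
    have e4 : m + 1 + 1 + 2 * (k + 1) = m + 2 + 2 * (k + 1) := by ring
    have e5 : 2 * k + 2 = 2 + 2 * k := by ring
    rw [e1, e2, e3, e4]
    rw [e5] at ih
    field_simp
    linear_combination ((1 - q ^ (m + 2 + 1 + 2 * k)) * (1 - q ^ (m + 2 + 2 * (k + 1)))) * ih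

lemma gco_r2 {q : ℝ} (h0 : 0 < q) (h1 : q < 1) (m k : ℕ) :
    gco q m (k + 1) * ((1 - q ^ (2 * m + 1)) * (1 - q ^ (2 * m + 3)) * (1 - q ^ (2 * k + 2))) =
      (1 - q ^ m) * (1 - q ^ (m + 1)) * (1 - q ^ (2 * m + 2 * k + 3)) * gco q (m + 2) k := by
  induction k with
  | zero =>
    rw [gco_succ, gco_zero, gco_zero]
    have a1 := (one_sub_pow_pos h0 h1 (2 * m)).ne'
    have a2 := (one_sub_pow_pos h0 h1 1).ne'
    norm_num at *
    field_simp
  | succ k ih =>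
    rw [gco_succ, gco_succ q (m + 2) k]
    have a1 := (one_sub_pow_pos' h0 h1 (n := 2 * m + 2 * k + 3) (by lia)).ne'
    have a3 := (one_sub_pow_pos' h0 h1 (n := 2 * m + 2 * (k + 1) + 3) (by lia)).ne'
    have a2 := (one_sub_pow_pos' h0 h1 (n := 2 + 2 * (k + 1)) (by lia)).ne'
    have a4 := (one_sub_pow_pos' h0 h1 (n := 2 + 2 * k) (by lia)).ne'
    have e1 : 2 * (m + 2) + 1 + 2 * k = 2 * m + 2 * (k + 1) + 3 := by ring
    have e0 : 2 * m + 1 + 2 * (k + 1) = 2 * m + 2 * k + 3 := by ring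
    have e2 : 2 * (k + 1) + 2 = 2 + 2 * (k + 1) := by ring
    have e3 : m + 2 * (k + 1) = m + 2 + 2 * k := by ring
    have e4 : m + 1 + 2 * (k + 1) = m + 2 + 1 + 2 * k := by ring
    have e5 : 2 * k + 2 = 2 + 2 * k := by ring
    rw [e1, e0, e2, e3, e4]
    rw [e5] at ih
    field_simp
    linear_combination ((1 - q ^ (m + 2 + 1 + 2 * k)) * (1 - q ^ (m + 2 + 2 * k))) * ih

lemma gco_contig {q : ℝ} (h0 : 0 < q) (h1 : q < 1) (m k : ℕ) :
    gco q m (k + 1) = gco q (m + 1) (k + 1) -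
      q ^ m * (1 - q ^ (m + 1)) ^ 2 / ((1 - q ^ (2 * m + 1)) * (1 - q ^ (2 * m + 3))) *
        gco q (m + 2) k := by
  have r1 := gco_r1 h0 h1 m k
  have r2 := gco_r2 h0 h1 m k
  have a1 := (one_sub_pow_pos' h0 h1 (n := 2 * m + 1) (by lia)).ne'
  have a2 := (one_sub_pow_pos' h0 h1 (n := 2 * m + 3) (by lia)).ne'
  have a3 := (one_sub_pow_pos' h0 h1 (n := 2 * k + 2) (by lia)).ne'
  rw [← eq_div_iff (by positivity)] at r1 r2
  rw [r1, r2]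
  field_simp
  ring

lemma gco_nonneg {q : ℝ} (h0 : 0 < q) (h1 : q < 1) (m k : ℕ) : 0 ≤ gco q m k := by
  apply Finset.prod_nonneg
  intro j _
  have hp : ∀ n : ℕ, 0 ≤ 1 - q ^ n := fun n => sub_nonneg.mpr (pow_le_one₀ h0.le h1.le)
  exact div_nonneg (mul_nonneg (hp _) (hp _)) (mul_nonneg (hp _) (hp _))

/-- Uniform majorant of the coefficients. -/
noncomputable def gmaj (q : ℝ) (k : ℕ) : ℝ := ∏ j ∈ Finset.range k, (1 / (1 - q ^ (2 + 2 * j)))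

lemma gmaj_pos {q : ℝ} (h0 : 0 < q) (h1 : q < 1) (k : ℕ) : 0 < gmaj q k :=
  Finset.prod_pos (fun j _ => one_div_pos.mpr (one_sub_pow_pos' h0 h1 (by lia)))

lemma gco_le {q : ℝ} (h0 : 0 < q) (h1 : q < 1) (m k : ℕ) : gco q m k ≤ gmaj q k := by
  have hp : ∀ n : ℕ, 0 ≤ 1 - q ^ n := fun n => sub_nonneg.mpr (pow_le_one₀ h0.le h1.le)
  apply Finset.prod_le_prod
  · intro j _
    exact div_nonneg (mul_nonneg (hp _) (hp _)) (mul_nonneg (hp _) (hp _))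
  · intro j _
    have a1 := (one_sub_pow_pos' h0 h1 (n := 2 * m + 1 + 2 * j) (by lia))
    have a2 := (one_sub_pow_pos' h0 h1 (n := 2 + 2 * j) (by lia))
    rw [div_le_div_iff₀ (by positivity) a2, one_mul]
    apply mul_le_mul_of_nonneg_right _ a2.le
    have i1 : q ^ (2 * m + 1 + 2 * j) ≤ q ^ (m + 1 + 2 * j) :=
      pow_le_pow_of_le_one h0.le h1.le (by lia)
    have i2 : 0 ≤ q ^ (m + 2 * j) := by positivity
    nlinarith [mul_nonneg i2 (hp (m + 1 + 2 * j))]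

lemma gmaj_summable {q y : ℝ} (h0 : 0 < q) (h1 : q < 1) (hy0 : 0 < y) (hy1 : y < 1) :
    Summable (fun k => gmaj q k * y ^ k) := by
  apply summable_of_ratio_test_tendsto_lt_one hy1
  · exact Eventually.of_forall (fun k => (mul_pos (gmaj_pos h0 h1 k) (pow_pos hy0 k)).ne')
  · have e : ∀ k : ℕ, ‖gmaj q (k + 1) * y ^ (k + 1)‖ / ‖gmaj q k * y ^ k‖ =
        y / (1 - q ^ 2 * (q ^ 2) ^ k) := by
      intro k
      have p1 := gmaj_pos h0 h1 k
      have p2 := gmaj_pos h0 h1 (k + 1)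
      have a2 := (one_sub_pow_pos' h0 h1 (n := 2 + 2 * k) (by lia)).ne'
      have e2 : q ^ 2 * (q ^ 2) ^ k = q ^ (2 + 2 * k) := by rw [pow_add, pow_mul]
      rw [Real.norm_of_nonneg (by positivity), Real.norm_of_nonneg (by positivity), e2]
      have : gmaj q (k + 1) = gmaj q k * (1 / (1 - q ^ (2 + 2 * k))) := by
        unfold gmaj; rw [Finset.prod_range_succ]
      rw [this, pow_succ]
      field_simp
    simp only [e]
    have t := tendsto_pow_atTop_nhds_zero_of_lt_one (r := q ^ 2) (by positivity)
      (pow_lt_one₀ h0.le h1 two_ne_zero)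
    have t2 := (t.const_mul (q ^ 2)).const_sub 1
    rw [mul_zero, sub_zero] at t2
    have t3 := (tendsto_const_nhds (x := y)).div t2 one_ne_zero
    rwa [div_one] at t3

lemma gterm_bound {q y : ℝ} (h0 : 0 < q) (h1 : q < 1) (hy0 : 0 < y) (m k : ℕ) :
    ‖gco q m k * (-y) ^ k‖ ≤ gmaj q k * y ^ k := by
  rw [norm_mul, norm_pow, norm_neg, Real.norm_of_nonneg hy0.le,
    Real.norm_of_nonneg (gco_nonneg h0 h1 m k)]
  exact mul_le_mul_of_nonneg_right (gco_le h0 h1 m k) (by positivity)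

lemma gterm_summable {q y : ℝ} (h0 : 0 < q) (h1 : q < 1) (hy0 : 0 < y) (hy1 : y < 1) (m : ℕ) :
    Summable (fun k => gco q m k * (-y) ^ k) :=
  Summable.of_norm_bounded (gmaj_summable h0 h1 hy0 hy1) (gterm_bound h0 h1 hy0 m)

lemma gfun_bound {q y : ℝ} (h0 : 0 < q) (h1 : q < 1) (hy0 : 0 < y) (hy1 : y < 1) (m : ℕ) :
    |gfun q y m| ≤ ∑' k, gmaj q k * y ^ k :=
  tsum_of_norm_bounded (gmaj_summable h0 h1 hy0 hy1).hasSum (gterm_bound h0 h1 hy0 m)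

lemma gfun_zero (q y : ℝ) : gfun q y 0 = 1 := by
  unfold gfun
  rw [tsum_eq_single 0]
  · simp [gco]
  · intro k hk
    obtain ⟨k, rfl⟩ := Nat.exists_eq_succ_of_ne_zero hk
    have : gco q 0 (k + 1) = 0 := by
      unfold gco
      rw [Finset.prod_range_succ']
      simp
    rw [Nat.succ_eq_add_one, this, zero_mul]

lemma gfun_contig {q y : ℝ} (h0 : 0 < q) (h1 : q < 1) (hy0 : 0 < y) (hy1 : y < 1) (m : ℕ) :
    gfun q y m = gfun q y (m + 1) +
      y * (q ^ m * (1 - q ^ (m + 1)) ^ 2 / ((1 - q ^ (2 * m + 1)) * (1 - q ^ (2 * m + 3)))) *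
        gfun q y (m + 2) := by
  have s0 := gterm_summable h0 h1 hy0 hy1 m
  have s1 := gterm_summable h0 h1 hy0 hy1 (m + 1)
  have s2 := gterm_summable h0 h1 hy0 hy1 (m + 2)
  unfold gfun
  rw [s0.tsum_eq_zero_add, s1.tsum_eq_zero_add, gco_zero, gco_zero, add_assoc, ← tsum_mul_left,
    ← Summable.tsum_add ((summable_nat_add_iff 1).mpr s1) (s2.mul_left _)]
  congr 1
  apply tsum_congr
  intro k
  rw [gco_contig h0 h1, pow_succ]
  ring

lemma gco_one {q : ℝ} (h0 : 0 < q) (h1 : q < 1) (k : ℕ) :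
    gco q 1 k = (1 - q) / (1 - q ^ (2 * k + 1)) := by
  induction k with
  | zero =>
    have : 1 - q ≠ 0 := by linarith
    simp [gco, this]
  | succ k ih =>
    rw [gco_succ, ih]
    have a1 := (one_sub_pow_pos' h0 h1 (n := 2 * k + 1) (by lia)).ne'
    have a2 := (one_sub_pow_pos' h0 h1 (n := 2 + 2 * k) (by lia)).ne'
    have a3 := (one_sub_pow_pos' h0 h1 (n := 2 * (k + 1) + 1) (by lia)).ne'
    have e1 : 1 + 2 * k = 2 * k + 1 := by ring
    have e2 : 1 + 1 + 2 * k = 2 + 2 * k := by ring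
    have e3 : 2 * 1 + 1 + 2 * k = 2 * (k + 1) + 1 := by ring
    rw [e1, e2, e3]
    field_simp

lemma gfun_one {q y : ℝ} (h0 : 0 < q) (h1 : q < 1) (hy0 : 0 < y) (hy1 : y < 1) :
    gfun q y 1 = (1 - q) * ∑' n : ℕ, q ^ n / (1 + y * q ^ (2 * n)) := by
  have hsum : Summable (Function.uncurry (fun k n : ℕ => (-y) ^ k * q ^ ((2 * k + 1) * n))) := by
    have hb := (summable_geometric_of_lt_one hy0.le hy1).mul_of_nonneg
      (summable_geometric_of_lt_one h0.le h1) (fun n => by positivity) (fun n => by positivity)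
    refine Summable.of_norm_bounded hb ?_
    rintro ⟨k, n⟩
    simp only [Function.uncurry]
    rw [norm_mul, norm_pow, norm_neg, Real.norm_of_nonneg hy0.le, Real.norm_of_nonneg (by positivity)]
    apply mul_le_mul_of_nonneg_left _ (by positivity)
    exact pow_le_pow_of_le_one h0.le h1.le (by nlinarith)
  have hc := hsum.tsum_comm
  have e1 : ∀ k : ℕ, ∑' n : ℕ, (-y) ^ k * q ^ ((2 * k + 1) * n) = (-y) ^ k / (1 - q ^ (2 * k + 1)) := by
    intro k
    simp only [pow_mul q]
    rw [tsum_mul_left, tsum_geometric_of_lt_one (by positivity) (pow_lt_one₀ h0.le h1 (by lia))]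
    rfl
  have e2 : ∀ n : ℕ, ∑' k : ℕ, (-y) ^ k * q ^ ((2 * k + 1) * n) = q ^ n / (1 + y * q ^ (2 * n)) := by
    intro n
    have e : ∀ k : ℕ, (-y) ^ k * q ^ ((2 * k + 1) * n) = q ^ n * (-y * q ^ (2 * n)) ^ k := by
      intro k
      rw [mul_pow, ← pow_mul]
      have : (2 * k + 1) * n = n + 2 * n * k := by ring
      rw [this, pow_add]; ring
    simp only [e]
    have hlt : ‖-y * q ^ (2 * n)‖ < 1 := by
      rw [norm_mul, norm_neg, Real.norm_of_nonneg hy0.le, Real.norm_of_nonneg (by positivity)]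
      have : q ^ (2 * n) ≤ 1 := pow_le_one₀ h0.le h1.le
      nlinarith
    rw [tsum_mul_left, tsum_geometric_of_norm_lt_one hlt, neg_mul, sub_neg_eq_add]
    rfl
  simp only [e1, e2] at hc
  rw [hc, ← tsum_mul_left]
  unfold gfun
  apply tsum_congr
  intro k
  rw [gco_one h0 h1]
  ring

lemma pcn_add_two (q y : ℝ) (n : ℕ) : pcn q y (n + 2) = y * (q ^ n * (1 - q ^ (n + 1)) ^ 2) := by
  simp [pcn]

lemma cfb_succ (q : ℝ) (n : ℕ) : cfb q (n + 1) = 1 - q ^ (2 * n + 1) := rfl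

lemma cfb_pos {q : ℝ} (h0 : 0 < q) (h1 : q < 1) (n : ℕ) : 0 < cfb q (n + 1) := by
  rw [cfb_succ]; exact one_sub_pow_pos h0 h1 _

lemma cfb_ge {q : ℝ} (h0 : 0 < q) (h1 : q < 1) (n : ℕ) : 1 - q ≤ cfb q (n + 1) := by
  rw [cfb_succ]
  have : q ^ (2 * n + 1) ≤ q ^ 1 := pow_le_pow_of_le_one h0.le h1.le (by lia)
  rw [pow_one] at this
  linarith

lemma pcn_nonneg {q y : ℝ} (h0 : 0 < q) (hy0 : 0 ≤ y) (n : ℕ) : 0 ≤ pcn q y n := by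
  unfold pcn
  split_ifs
  · exact zero_le_one
  · positivity

lemma pcn_le {q y : ℝ} (h0 : 0 < q) (h1 : q < 1) (hy0 : 0 ≤ y) (hy1 : y ≤ 1) (n : ℕ) :
    pcn q y (n + 2) ≤ q ^ n := by
  rw [pcn_add_two]
  have i1 : 0 < 1 - q ^ (n + 1) := one_sub_pow_pos h0 h1 n
  have i2 : 0 < q ^ (n + 1) := by positivity
  have i3 : (1 - q ^ (n + 1)) ^ 2 ≤ 1 := by nlinarith
  have i4 : 0 < q ^ n := by positivity
  have i5 : q ^ n * (1 - q ^ (n + 1)) ^ 2 ≤ q ^ n := by nlinarith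
  have i6 : 0 ≤ q ^ n * (1 - q ^ (n + 1)) ^ 2 := by positivity
  nlinarith

lemma cfDen_pos {q y : ℝ} (h0 : 0 < q) (h1 : q < 1) (hy0 : 0 ≤ y) (n : ℕ) :
    0 ≤ (cfDen (pcn q y) (cfb q) n).1 ∧ 0 < (cfDen (pcn q y) (cfb q) n).2 := by
  induction n with
  | zero => simp [cfDen]
  | succ n ih =>
    obtain ⟨i1, i2⟩ := ih
    have b := cfb_pos h0 h1 n
    have c := pcn_nonneg h0 hy0 (n + 1)
    simp only [cfDen]
    exact ⟨i2.le, by positivity⟩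

lemma cfDen_ge {q y : ℝ} (h0 : 0 < q) (h1 : q < 1) (hy0 : 0 ≤ y) (n : ℕ) :
    (1 - q) * (cfDen (pcn q y) (cfb q) n).2 ≤ (cfDen (pcn q y) (cfb q) (n + 1)).2 := by
  obtain ⟨i1, i2⟩ := cfDen_pos h0 h1 hy0 n
  have b := cfb_ge h0 h1 n
  have c := pcn_nonneg h0 hy0 (n + 1)
  simp only [cfDen]
  nlinarith [mul_nonneg c i1, mul_le_mul_of_nonneg_right b i2.le]

/-- Ratio-type summability lemma. -/
lemma summable_of_q_ratio {q C : ℝ} (h0 : 0 < q) (h1 : q < 1) (u : ℕ → ℝ) (hu : ∀ n, 0 ≤ u n)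
    (h : ∀ n, u (n + 1) ≤ C * q ^ n * u n) : Summable u := by
  apply summable_of_ratio_norm_eventually_le (r := 1 / 2) (by norm_num)
  have t := (tendsto_pow_atTop_nhds_zero_of_lt_one h0.le h1).const_mul C
  rw [mul_zero] at t
  filter_upwards [t.eventually_le_const (by norm_num : (0 : ℝ) < 1 / 2)] with n hn
  rw [Real.norm_of_nonneg (hu _), Real.norm_of_nonneg (hu _)]
  exact (h n).trans (mul_le_mul_of_nonneg_right hn (hu n))

noncomputable def cft (q y : ℝ) : ℕ → ℝ
  | 0 => 1 / (1 - q)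
  | n + 1 => -cft q y n * pcn q y (n + 2) / cfb q (n + 2)

lemma cf_error {q y : ℝ} (h0 : 0 < q) (h1 : q < 1) (hy0 : 0 < y) (hy1 : y < 1) (n : ℕ) :
    (gfun q y 1 / (1 - q) * (cfDen (pcn q y) (cfb q) n).2 - (cfNum (pcn q y) (cfb q) n).2
        = cft q y n * gfun q y (n + 1)) ∧
    pcn q y (n + 1) *
      (gfun q y 1 / (1 - q) * (cfDen (pcn q y) (cfb q) n).1 - (cfNum (pcn q y) (cfb q) n).1)
        = -cft q y n * cfb q (n + 1) * gfun q y n := by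
  induction n with
  | zero =>
    have : 1 - q ≠ 0 := by linarith
    simp only [cfDen, cfNum, cft, zero_add, gfun_zero]
    constructor
    · ring
    · simp [pcn, cfb, this]
  | succ n ih =>
    obtain ⟨i1, i2⟩ := ih
    have b1 := (cfb_pos h0 h1 n).ne'
    have b2 := (cfb_pos h0 h1 (n + 1)).ne'
    constructor
    · simp only [cfDen, cfNum]
      have hg := gfun_contig h0 h1 hy0 hy1 n
      have e : cft q y (n + 1) = -cft q y n * cfb q (n + 1) *
          (y * (q ^ n * (1 - q ^ (n + 1)) ^ 2 / ((1 - q ^ (2 * n + 1)) * (1 - q ^ (2 * n + 3))))) := by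
        simp only [cft]
        rw [pcn_add_two]
        rw [cfb_succ] at *
        have e3 : 2 * (n + 1) + 1 = 2 * n + 3 := by ring
        rw [cfb_succ, e3] at *
        field_simp
      rw [e]
      linear_combination cfb q (n + 1) * i1 + i2 - cft q y n * cfb q (n + 1) * hg
    · have e : -cft q y (n + 1) * cfb q (n + 2) = cft q y n * pcn q y (n + 2) := by
        simp only [cft]
        field_simp
      show pcn q y (n + 2) * (_ * (cfDen (pcn q y) (cfb q) n).2 - (cfNum (pcn q y) (cfb q) n).2) = 
        -cft q y (n + 1) * cfb q (n + 2) * gfun q y (n + 1)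
      rw [i1, e]; ring

lemma cf_tendsto_lt {q y : ℝ} (h0 : 0 < q) (h1 : q < 1) (hy0 : 0 < y) (hy1 : y < 1) :
    CFTendsto (pcn q y) (cfb q) (∑' n : ℕ, q ^ n / (1 + y * q ^ (2 * n))) := by
  have hq' : 0 < 1 - q := by linarith
  have hS : gfun q y 1 / (1 - q) = ∑' n : ℕ, q ^ n / (1 + y * q ^ (2 * n)) := by
    rw [gfun_one h0 h1 hy0 hy1]; field_simp
  rw [← hS]
  set D := fun n => (cfDen (pcn q y) (cfb q) n).2 with hD
  have D0 : ∀ n, 0 < D n := fun n => (cfDen_pos h0 h1 hy0.le n).2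
  have hu : Summable (fun n => |cft q y n| / D n) := by
    refine summable_of_q_ratio (C := 1 / (1 - q) ^ 2) h0 h1 _
      (fun n => div_nonneg (abs_nonneg _) (D0 n).le) (fun n => ?_)
    have d1 : (1 - q) * D n ≤ D (n + 1) := cfDen_ge h0 h1 hy0.le n
    have c1 := pcn_le h0 h1 hy0.le hy1.le n
    have c0 := pcn_nonneg h0 hy0.le (n + 2)
    have b0 := cfb_pos h0 h1 (n + 1)
    have b1 := cfb_ge h0 h1 (n + 1)
    have Dn := D0 n
    simp only [cft]
    rw [abs_div, abs_mul, abs_neg, abs_of_nonneg c0, abs_of_pos b0]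
    calc |cft q y n| * pcn q y (n + 2) / cfb q (n + 2) / D (n + 1)
        ≤ |cft q y n| * q ^ n / (1 - q) / ((1 - q) * D n) := by gcongr
      _ = 1 / (1 - q) ^ 2 * q ^ n * (|cft q y n| / D n) := by field_simp
  have t := (hu.tendsto_atTop_zero).mul_const (∑' k, gmaj q k * y ^ k)
  rw [zero_mul] at t
  unfold CFTendsto
  rw [tendsto_iff_norm_sub_tendsto_zero]
  refine squeeze_zero (fun n => norm_nonneg _) (fun n => ?_) t
  have he := (cf_error h0 h1 hy0 hy1 n).1
  have hb := gfun_bound h0 h1 hy0 hy1 (n + 1)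
  have Dn := D0 n
  have e : (cfNum (pcn q y) (cfb q) n).2 / (cfDen (pcn q y) (cfb q) n).2 - gfun q y 1 / (1 - q) =
      -(cft q y n * gfun q y (n + 1)) / D n := by
    have Dn' : 0 < (cfDen (pcn q y) (cfb q) n).2 := Dn
    simp only [hD]
    rw [← he]
    field_simp
    ring
  rw [e, Real.norm_eq_abs, abs_div, abs_neg, abs_mul, abs_of_pos Dn]
  calc |cft q y n| * |gfun q y (n + 1)| / D n
      = |cft q y n| / D n * |gfun q y (n + 1)| := by ring
    _ ≤ _ := by gcongr

noncomputable def cfA (q y : ℝ) (n : ℕ) : ℝ :=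
  (cfNum (pcn q y) (cfb q) n).2 / (cfDen (pcn q y) (cfb q) n).2

noncomputable def cfB (q : ℝ) : ℕ → ℝ
  | 0 => 1 / (1 - q)
  | n + 1 => 1 / (1 - q) ^ 2 * q ^ n * cfB q n

lemma cfB_nonneg {q : ℝ} (h0 : 0 < q) (h1 : q < 1) (n : ℕ) : 0 ≤ cfB q n := by
  induction n with
  | zero => simp only [cfB]; have : 0 < 1 - q := by linarith
            positivity
  | succ n ih => simp only [cfB]; positivity

lemma cfB_summable {q : ℝ} (h0 : 0 < q) (h1 : q < 1) : Summable (cfB q) :=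
  summable_of_q_ratio (C := 1 / (1 - q) ^ 2) h0 h1 _ (cfB_nonneg h0 h1) (fun _ => le_rfl)

lemma cfA_diff {q y : ℝ} (h0 : 0 < q) (h1 : q < 1) (hy0 : 0 ≤ y) (hy1 : y ≤ 1) (n : ℕ) :
    |cfA q y (n + 1) - cfA q y n| ≤ cfB q n := by
  have hq' : 0 < 1 - q := by linarith
  induction n with
  | zero =>
    simp [cfA, cfNum, cfDen, cfB, pcn, cfb]
    rw [abs_of_pos hq']
  | succ n ih =>
    obtain ⟨N1, hN1⟩ : ∃ z, z = (cfNum (pcn q y) (cfb q) n).1 := ⟨_, rfl⟩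
    have Dn := (cfDen_pos h0 h1 hy0 n).2
    have Dn1 := (cfDen_pos h0 h1 hy0 (n + 1)).2
    have Dn2 := (cfDen_pos h0 h1 hy0 (n + 2)).2
    have g1 := cfDen_ge h0 h1 hy0 n
    have g2 := cfDen_ge h0 h1 hy0 (n + 1)
    have c0 := pcn_nonneg h0 hy0 (n + 2)
    have c1 := pcn_le h0 h1 hy0 hy1 n
    have rN : (cfNum (pcn q y) (cfb q) (n + 2)).2 = cfb q (n + 2) * (cfNum (pcn q y) (cfb q) (n + 1)).2
      + pcn q y (n + 2) * (cfNum (pcn q y) (cfb q) n).2 := rfl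
    have rD : (cfDen (pcn q y) (cfb q) (n + 2)).2 = cfb q (n + 2) * (cfDen (pcn q y) (cfb q) (n + 1)).2
      + pcn q y (n + 2) * (cfDen (pcn q y) (cfb q) n).2 := rfl
    have e : cfA q y (n + 2) - cfA q y (n + 1) =
        -(pcn q y (n + 2) * (cfDen (pcn q y) (cfb q) n).2 / (cfDen (pcn q y) (cfb q) (n + 2)).2) *
          (cfA q y (n + 1) - cfA q y n) := by
      unfold cfA
      field_simp
      rw [rN, rD]
      ring
    rw [show n + 1 + 1 = n + 2 from rfl, e, abs_mul, abs_neg]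
    simp only [cfB]
    apply mul_le_mul _ ih (abs_nonneg _) (by positivity)
    rw [abs_of_nonneg (by positivity), div_le_iff₀ Dn2]
    have g3 : (1 - q) ^ 2 * (cfDen (pcn q y) (cfb q) n).2 ≤ (cfDen (pcn q y) (cfb q) (n + 2)).2 := by
      nlinarith [mul_le_mul_of_nonneg_left g1 hq'.le]
    calc pcn q y (n + 2) * (cfDen (pcn q y) (cfb q) n).2
        ≤ q ^ n * (cfDen (pcn q y) (cfb q) n).2 := by gcongr
      _ = 1 / (1 - q) ^ 2 * q ^ n * ((1 - q) ^ 2 * (cfDen (pcn q y) (cfb q) n).2) := by field_simp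
      _ ≤ _ := by gcongr

lemma cfA_zero (q y : ℝ) : cfA q y 0 = 0 := by simp [cfA, cfNum]

lemma cfA_summable {q y : ℝ} (h0 : 0 < q) (h1 : q < 1) (hy0 : 0 ≤ y) (hy1 : y ≤ 1) :
    Summable (fun n => cfA q y (n + 1) - cfA q y n) :=
  Summable.of_norm_bounded (cfB_summable h0 h1) (cfA_diff h0 h1 hy0 hy1)

lemma cfA_tendsto {q y : ℝ} (h0 : 0 < q) (h1 : q < 1) (hy0 : 0 ≤ y) (hy1 : y ≤ 1) :
    Tendsto (cfA q y) atTop (nhds (∑' n, (cfA q y (n + 1) - cfA q y n))) := by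
  have h := (cfA_summable h0 h1 hy0 hy1).hasSum.tendsto_sum_nat
  simpa only [Finset.sum_range_sub, cfA_zero, sub_zero] using h

lemma pcn_cont (q : ℝ) (n : ℕ) : Continuous (fun y => pcn q y n) := by
  unfold pcn
  split_ifs
  · exact continuous_const
  · fun_prop

lemma cfNum_cont (q : ℝ) (n : ℕ) : Continuous (fun y => cfNum (pcn q y) (cfb q) n) := by
  induction n with
  | zero => simp only [cfNum]; exact continuous_const
  | succ n ih =>
    have := pcn_cont q (n + 1)
    simp only [cfNum]
    fun_prop

lemma cfDen_cont (q : ℝ) (n : ℕ) : Continuous (fun y => cfDen (pcn q y) (cfb q) n) := by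
  induction n with
  | zero => simp only [cfDen]; exact continuous_const
  | succ n ih =>
    have := pcn_cont q (n + 1)
    simp only [cfDen]
    fun_prop

lemma cfA_cont {q : ℝ} (h0 : 0 < q) (h1 : q < 1) (n : ℕ) : ContinuousAt (fun y => cfA q y n) 1 := by
  unfold cfA
  exact ((cfNum_cont q n).snd.continuousAt).div ((cfDen_cont q n).snd.continuousAt)
    (cfDen_pos h0 h1 zero_le_one n).2.ne'

lemma cf_tendsto_one {q : ℝ} (h0 : 0 < q) (h1 : q < 1) :
    Tendsto (cfA q 1) atTop (nhds (∑' n : ℕ, q ^ n / (1 + q ^ (2 * n)))) := by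
  have hA := cfA_tendsto h0 h1 zero_le_one (le_refl (1 : ℝ))
  have hev : ∀ᶠ y : ℝ in nhdsWithin 1 (Set.Iio 1), 0 < y ∧ y < 1 := by
    have : Set.Ioo (0 : ℝ) 1 ∈ nhdsWithin 1 (Set.Iio 1) := Ioo_mem_nhdsLT one_pos
    exact this
  have l1 : Tendsto (fun y => ∑' n, (cfA q y (n + 1) - cfA q y n)) (nhdsWithin 1 (Set.Iio 1))
      (nhds (∑' n, (cfA q 1 (n + 1) - cfA q 1 n))) := by
    refine tendsto_tsum_of_dominated_convergence (cfB_summable h0 h1) ?_ ?_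
    · intro n
      exact (((cfA_cont h0 h1 (n + 1)).sub (cfA_cont h0 h1 n)).tendsto).mono_left nhdsWithin_le_nhds
    · filter_upwards [hev] with y hy n
      exact cfA_diff h0 h1 hy.1.le hy.2.le n
  have l2 : Tendsto (fun y : ℝ => ∑' n : ℕ, q ^ n / (1 + y * q ^ (2 * n))) (nhdsWithin 1 (Set.Iio 1))
      (nhds (∑' n : ℕ, q ^ n / (1 + 1 * q ^ (2 * n)))) := by
    refine tendsto_tsum_of_dominated_convergence (summable_geometric_of_lt_one h0.le h1) ?_ ?_
    · intro n
      have : ContinuousAt (fun y : ℝ => q ^ n / (1 + y * q ^ (2 * n))) 1 := by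
        apply ContinuousAt.div continuousAt_const (by fun_prop)
        positivity
      exact this.tendsto.mono_left nhdsWithin_le_nhds
    · filter_upwards [hev] with y hy n
      have := hy.1
      rw [Real.norm_of_nonneg (by positivity)]
      apply div_le_self (by positivity)
      have : 0 ≤ y * q ^ (2 * n) := by positivity
      linarith
  have l3 : (fun y => ∑' n, (cfA q y (n + 1) - cfA q y n)) =ᶠ[nhdsWithin 1 (Set.Iio 1)]
      (fun y : ℝ => ∑' n : ℕ, q ^ n / (1 + y * q ^ (2 * n))) := by
    filter_upwards [hev] with y hy
    exact tendsto_nhds_unique (cfA_tendsto h0 h1 hy.1.le hy.2.le) (cf_tendsto_lt h0 h1 hy.1 hy.2)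
  have l4 := tendsto_nhds_unique (l1.congr' l3) l2
  rw [l4] at hA
  simpa only [one_mul] using hA

/-- Proposition 5: `K(k_r)/(2π) + 1/4 =
1/(1-q +) (1-q)²/(1-q³ +) q(1-q²)²/(1-q⁵ +) q²(1-q³)²/(1-q⁷ +) ⋯`
with `q = e^{-π√r}`. -/
theorem stmt_5 (r : ℝ) (hr : 0 < r) (q : ℝ) (hq : q = Real.exp (-Real.pi * Real.sqrt r))
    (k : ℝ) (hk0 : 0 < k) (hk1 : k < 1)
    (hK : Kint (Real.sqrt (1 - k ^ 2)) = Real.sqrt r * Kint k) :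
    CFTendsto
      (fun n => if n = 1 then 1 else q ^ (n - 2) * (1 - q ^ (n - 1)) ^ 2)
      (fun n => 1 - q ^ (2 * n - 1))
      (Kint k / (2 * Real.pi) + 1 / 4) := by
  have ht : 0 < Real.sqrt r := Real.sqrt_pos.mpr hr
  have hx : 0 < Real.pi * Real.sqrt r := by positivity
  have hq' : q = Real.exp (-(Real.pi * Real.sqrt r)) := by rw [hq, neg_mul]
  have h0 : 0 < q := by rw [hq]; exact Real.exp_pos _
  have h1 : q < 1 := by rw [hq', Real.exp_lt_one_iff]; linarith
  have hval : Kint k / (2 * Real.pi) + 1 / 4 = ∑' n : ℕ, q ^ n / (1 + q ^ (2 * n)) := by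
    rw [← sa_eq_series hx hq', kint_eq_sa ht hk0 hk1 hK]
    have := Real.pi_pos
    field_simp
    ring
  rw [hval]
  have hc : (fun n : ℕ => if n = 1 then (1 : ℝ) else q ^ (n - 2) * (1 - q ^ (n - 1)) ^ 2) = pcn q 1 := by
    funext n
    simp [pcn]
  rw [hc]
  exact cf_tendsto_one h0 h1
end
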